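/- Let C₀, M > 0 and α > 0. There exists a constant C₅ > 0, depending only on α, L, T, C₀, M (and not on ε), such that for every ε ∈ (0,1) and every classical solution u of the regularized problem (2.9) whose smooth data satisfy C₀⁻¹(1−y) ≤ u₀^ε, u₁^ε ≤ C₀(1−y), v₀^ε ≤ 0, with the C²-norms of u₀^ε, u₁^ε, v₀^ε, U, P bounded by M and U ≥ M⁻¹, and which satisfies C₁⁻¹(1−y) ≤ u ≤ C₁(1−y) on Q_T for some C₁ ≤ M, one has the weighted second-derivative bound ∫_{Q_T} (1−y)^α |∂_y² u| dx dy dt ≤ C₅. -/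

import Mathlib

open Real Set MeasureTheory

noncomputable section

/-- Partial derivative in the first variable of a two-variable function. -/
def pd1 (f : ℝ → ℝ → ℝ) (x t : ℝ) : ℝ := deriv (fun x' => f x' t) x

/-- Partial derivative in the second variable of a two-variable function. -/
def pd2 (f : ℝ → ℝ → ℝ) (x t : ℝ) : ℝ := deriv (fun t' => f x t') t

/-- Partial derivatives of a function of `(x, y, t)`. -/
def Dx (u : ℝ → ℝ → ℝ → ℝ) (x y t : ℝ) : ℝ := deriv (fun s => u s y t) x
def Dy (u : ℝ → ℝ → ℝ → ℝ) (x y t : ℝ) : ℝ := deriv (fun s => u x s t) y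
def Dt (u : ℝ → ℝ → ℝ → ℝ) (x y t : ℝ) : ℝ := deriv (fun s => u x y s) t
def Dyy (u : ℝ → ℝ → ℝ → ℝ) (x y t : ℝ) : ℝ := iteratedDeriv 2 (fun s => u x s t) y

/-- The coefficient `b = (1-y²)∂ₓU + (1-y)∂ₜU/U`. -/
def bcoef (U : ℝ → ℝ → ℝ) (x y t : ℝ) : ℝ :=
  (1 - y ^ 2) * pd1 U x t + (1 - y) * pd2 U x t / U x t

/-- The coefficient `c = (1-y)∂ₓU - ∂ₓP/U`. -/
def ccoef (U P : ℝ → ℝ → ℝ) (x y t : ℝ) : ℝ :=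
  (1 - y) * pd1 U x t - pd1 P x t / U x t

def Smooth2 (f : ℝ → ℝ → ℝ) : Prop := ContDiff ℝ (⊤ : ℕ∞) (fun p : ℝ × ℝ => f p.1 p.2)
def Smooth3 (u : ℝ → ℝ → ℝ → ℝ) : Prop :=
  ContDiff ℝ (⊤ : ℕ∞) (fun p : ℝ × ℝ × ℝ => u p.1 p.2.1 p.2.2)

/-- `C²`-norm of `f` bounded by `M` on `s₁ × s₂`. -/
def C2Bound (f : ℝ → ℝ → ℝ) (s₁ s₂ : Set ℝ) (M : ℝ) : Prop :=
  ∀ x ∈ s₁, ∀ t ∈ s₂,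
    |f x t| ≤ M ∧ |pd1 f x t| ≤ M ∧ |pd2 f x t| ≤ M ∧
    |pd1 (pd1 f) x t| ≤ M ∧ |pd2 (pd2 f) x t| ≤ M ∧ |pd2 (pd1 f) x t| ≤ M

/-- Background Euler flow data: smooth `U > 0`, `P`, Bernoulli law, favorable pressure,
`C²`-norms bounded by `M` and `U ≥ M⁻¹`. -/
def EulerData (L T M : ℝ) (U P : ℝ → ℝ → ℝ) : Prop :=
  Smooth2 U ∧ Smooth2 P ∧
  (∀ x ∈ Icc 0 L, ∀ t ∈ Icc 0 T, 0 < U x t) ∧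
  (∀ x ∈ Icc 0 L, ∀ t ∈ Icc 0 T, pd2 U x t + U x t * pd1 U x t + pd1 P x t = 0) ∧
  (∀ x ∈ Icc 0 L, ∀ t ∈ Icc 0 T, pd1 P x t ≤ 0) ∧
  C2Bound U (Icc 0 L) (Icc 0 T) M ∧ C2Bound P (Icc 0 L) (Icc 0 T) M ∧
  (∀ x ∈ Icc 0 L, ∀ t ∈ Icc 0 T, M⁻¹ ≤ U x t)

/-- Classical solution of the regularized problem (2.9). -/
def RegSolution (L T ε : ℝ) (U P : ℝ → ℝ → ℝ)
    (u₀ u₁ v₀ : ℝ → ℝ → ℝ) (u : ℝ → ℝ → ℝ → ℝ) : Prop :=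
  Smooth3 u ∧
  (∀ x ∈ Ioo 0 L, ∀ y ∈ Ioo (0:ℝ) 1, ∀ t ∈ Ioo 0 T,
    Dt u x y t - (u x y t + ε) ^ 2 * Dyy u x y t + (y * U x t + ε) * Dx u x y t
      + bcoef U x y t * Dy u x y t + ccoef U P x y t * u x y t = 0) ∧
  (∀ x ∈ Icc 0 L, ∀ y ∈ Icc (0:ℝ) 1, u x y 0 = u₀ x y) ∧
  (∀ y ∈ Icc (0:ℝ) 1, ∀ t ∈ Icc 0 T, u 0 y t = u₁ y t) ∧
  (∀ x ∈ Icc 0 L, ∀ t ∈ Icc 0 T, u x 1 t = 0) ∧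
  (∀ x ∈ Icc 0 L, ∀ t ∈ Icc 0 T,
    (u x 0 t + ε) * Dy u x 0 t = v₀ x t * (u x 0 t + ε) + pd1 P x t / U x t)

/-- The data bounds: smooth nonnegative data with `C₀⁻¹(1-y) ≤ u₀, u₁ ≤ C₀(1-y)`, `v₀ ≤ 0`. -/
def DataBounds (L T C₀ : ℝ) (u₀ u₁ v₀ : ℝ → ℝ → ℝ) : Prop :=
  Smooth2 u₀ ∧ Smooth2 u₁ ∧ Smooth2 v₀ ∧
  (∀ x ∈ Icc 0 L, ∀ y ∈ Icc (0:ℝ) 1,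
    C₀⁻¹ * (1 - y) ≤ u₀ x y ∧ u₀ x y ≤ C₀ * (1 - y)) ∧
  (∀ y ∈ Icc (0:ℝ) 1, ∀ t ∈ Icc 0 T,
    C₀⁻¹ * (1 - y) ≤ u₁ y t ∧ u₁ y t ≤ C₀ * (1 - y)) ∧
  (∀ x ∈ Icc 0 L, ∀ t ∈ Icc 0 T, v₀ x t ≤ 0)

/-- The parabolic cylinder `Q_T = (0,L) × (0,1) × (0,T)`. -/
def QT (L T : ℝ) : Set (ℝ × ℝ × ℝ) := (Ioo 0 L) ×ˢ ((Ioo (0:ℝ) 1) ×ˢ (Ioo 0 T))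

/-- The closed cylinder `[0,L] × [0,1] × [0,T]`. -/
def closedBox (L T : ℝ) : Set (ℝ × ℝ × ℝ) := Icc 0 L ×ˢ (Icc (0:ℝ) 1 ×ˢ Icc 0 T)

lemma QT_subset_closedBox (L T : ℝ) : QT L T ⊆ closedBox L T :=
  prod_mono Ioo_subset_Icc_self (prod_mono Ioo_subset_Icc_self Ioo_subset_Icc_self)

lemma measurableSet_QT (L T : ℝ) : MeasurableSet (QT L T) :=
  measurableSet_Ioo.prod (measurableSet_Ioo.prod measurableSet_Ioo)

lemma isCompact_closedBox (L T : ℝ) : IsCompact (closedBox L T) :=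
  isCompact_Icc.prod (isCompact_Icc.prod isCompact_Icc)

lemma integrableOn_QT {L T : ℝ} {f : ℝ × ℝ × ℝ → ℝ} (hf : ContinuousOn f (closedBox L T)) :
    IntegrableOn f (QT L T) :=
  (hf.integrableOn_compact (isCompact_closedBox L T)).mono_set (QT_subset_closedBox L T)

lemma setIntegral_Ioo_deriv {a b : ℝ} (hab : a ≤ b) {F G : ℝ → ℝ}
    (hF : ∀ x ∈ Icc a b, HasDerivAt F (G x) x) (hG : ContinuousOn G (Icc a b)) :
    ∫ x in Ioo a b, G x = F b - F a := by
  rw [← integral_Ioc_eq_integral_Ioo, ← intervalIntegral.integral_of_le hab]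
  apply intervalIntegral.integral_eq_sub_of_hasDerivAt
  · intro x hx; rw [uIcc_of_le hab] at hx; exact hF x hx
  · apply ContinuousOn.intervalIntegrable; rwa [uIcc_of_le hab]

lemma neg_integral_dx_le {L T : ℝ} (hL : 0 ≤ L) (hT : 0 ≤ T) {F G : ℝ × ℝ × ℝ → ℝ} {B : ℝ → ℝ}
    (hG : ContinuousOn G (closedBox L T)) (hB : IntegrableOn B (Ioo 0 1))
    (hF : ∀ x y t, (x, y, t) ∈ closedBox L T → HasDerivAt (fun s => F (s, y, t)) (G (x, y, t)) x)
    (hb : ∀ y ∈ Ioo (0:ℝ) 1, ∀ t ∈ Ioo 0 T, F (0, y, t) - F (L, y, t) ≤ B y) :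
    -∫ p in QT L T, G p ≤ T * ∫ y in Ioo (0:ℝ) 1, B y := by
  have hi : Integrable G ((volume.restrict (Ioo 0 L)).prod
      (volume.restrict (Ioo (0:ℝ) 1 ×ˢ Ioo 0 T))) := by
    rw [Measure.prod_restrict]; exact integrableOn_QT hG
  have e1 : ∫ p in QT L T, G p = ∫ w in Ioo (0:ℝ) 1 ×ˢ Ioo 0 T, ∫ x in Ioo 0 L, G (x, w) := by
    rw [← integral_prod_symm _ hi, Measure.prod_restrict]; rfl
  have hBi : IntegrableOn (fun w : ℝ × ℝ => B w.1) (Ioo (0:ℝ) 1 ×ˢ Ioo 0 T) := by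
    have : Integrable (fun w : ℝ × ℝ => B w.1 * 1) ((volume.restrict (Ioo (0:ℝ) 1)).prod
      (volume.restrict (Ioo 0 T))) := Integrable.mul_prod (g := fun _ => (1:ℝ)) hB (by simp)
    rw [Measure.prod_restrict] at this
    simp only [mul_one] at this
    exact this
  have e2 : ∫ w in Ioo (0:ℝ) 1 ×ˢ Ioo 0 T, B w.1 = T * ∫ y in Ioo (0:ℝ) 1, B y := by
    have := setIntegral_prod_mul (μ := volume) (ν := volume) B (fun _ => (1:ℝ)) (Ioo (0:ℝ) 1) (Ioo 0 T)
    simp only [mul_one] at this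
    rw [← Measure.volume_eq_prod] at this
    rw [this]
    simp [hT, mul_comm]
  rw [e1, ← e2, ← integral_neg]
  apply setIntegral_mono_on hi.integral_prod_right.neg hBi (measurableSet_Ioo.prod measurableSet_Ioo)
  rintro ⟨y, t⟩ ⟨hy, ht⟩
  have := setIntegral_Ioo_deriv hL (F := fun s => F (s, y, t)) (G := fun s => G (s, y, t))
    (fun x hx => hF x y t ⟨hx, Ioo_subset_Icc_self hy, Ioo_subset_Icc_self ht⟩)
    (hG.comp (by fun_prop) fun x hx => ⟨hx, Ioo_subset_Icc_self hy, Ioo_subset_Icc_self ht⟩)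
  simp only [Pi.neg_apply]
  rw [this]
  linarith [hb y hy t ht]

lemma neg_integral_slice_le {L T C : ℝ} (hL : 0 ≤ L) {G : ℝ × ℝ × ℝ → ℝ}
    (hG : ContinuousOn G (closedBox L T))
    (h : ∀ x ∈ Ioo 0 L, -∫ w in Ioo (0:ℝ) 1 ×ˢ Ioo 0 T, G (x, w) ≤ C) :
    -∫ p in QT L T, G p ≤ L * C := by
  have hi : Integrable G ((volume.restrict (Ioo 0 L)).prod
      (volume.restrict (Ioo (0:ℝ) 1 ×ˢ Ioo 0 T))) := by
    rw [Measure.prod_restrict]; exact integrableOn_QT hG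
  have e1 : ∫ p in QT L T, G p = ∫ x in Ioo 0 L, ∫ w in Ioo (0:ℝ) 1 ×ˢ Ioo 0 T, G (x, w) := by
    rw [← integral_prod _ hi, Measure.prod_restrict]; rfl
  have e2 : L * C = ∫ x in Ioo 0 L, C := by simp [hL]
  rw [e1, e2, ← integral_neg]
  exact setIntegral_mono_on hi.integral_prod_left.neg (by simp) measurableSet_Ioo h

lemma neg_integral_dt_le {L T : ℝ} (hL : 0 ≤ L) (hT : 0 ≤ T) {F G : ℝ × ℝ × ℝ → ℝ} {B : ℝ → ℝ}
    (hG : ContinuousOn G (closedBox L T)) (hB : IntegrableOn B (Ioo 0 1))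
    (hF : ∀ x y t, (x, y, t) ∈ closedBox L T → HasDerivAt (fun s => F (x, y, s)) (G (x, y, t)) t)
    (hb : ∀ x ∈ Ioo 0 L, ∀ y ∈ Ioo (0:ℝ) 1, F (x, y, 0) - F (x, y, T) ≤ B y) :
    -∫ p in QT L T, G p ≤ L * ∫ y in Ioo (0:ℝ) 1, B y := by
  apply neg_integral_slice_le hL hG
  intro x hx
  have hx' := Ioo_subset_Icc_self hx
  have hGx : ContinuousOn (fun w : ℝ × ℝ => G (x, w)) (Icc (0:ℝ) 1 ×ˢ Icc 0 T) :=
    hG.comp (by fun_prop) fun w hw => ⟨hx', hw⟩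
  have hi : Integrable (fun w : ℝ × ℝ => G (x, w)) ((volume.restrict (Ioo (0:ℝ) 1)).prod
      (volume.restrict (Ioo 0 T))) := by
    rw [Measure.prod_restrict]
    exact (hGx.integrableOn_compact (isCompact_Icc.prod isCompact_Icc)).mono_set
      (prod_mono Ioo_subset_Icc_self Ioo_subset_Icc_self)
  have e1 : ∫ w in Ioo (0:ℝ) 1 ×ˢ Ioo 0 T, G (x, w)
      = ∫ y in Ioo (0:ℝ) 1, ∫ t in Ioo 0 T, G (x, y, t) := by
    rw [← integral_prod _ hi, Measure.prod_restrict]; rfl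
  rw [e1, ← integral_neg]
  apply setIntegral_mono_on hi.integral_prod_left.neg hB measurableSet_Ioo
  intro y hy
  have hy' := Ioo_subset_Icc_self hy
  have := setIntegral_Ioo_deriv hT (F := fun s => F (x, y, s)) (G := fun s => G (x, y, s))
    (fun t ht => hF x y t ⟨hx', hy', ht⟩)
    (hG.comp (by fun_prop) fun t ht => ⟨hx', hy', ht⟩)
  simp only [Pi.neg_apply]
  rw [this]
  linarith [hb x hx y hy]

lemma neg_integral_dy_le {L T C : ℝ} (hL : 0 ≤ L) (hT : 0 ≤ T) {F G : ℝ × ℝ × ℝ → ℝ}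
    (hG : ContinuousOn G (closedBox L T))
    (hF : ∀ x y t, (x, y, t) ∈ closedBox L T → HasDerivAt (fun s => F (x, s, t)) (G (x, y, t)) y)
    (hb : ∀ x ∈ Ioo 0 L, ∀ t ∈ Ioo 0 T, F (x, 0, t) - F (x, 1, t) ≤ C) :
    -∫ p in QT L T, G p ≤ L * (T * C) := by
  apply neg_integral_slice_le hL hG
  intro x hx
  have hx' := Ioo_subset_Icc_self hx
  have hGx : ContinuousOn (fun w : ℝ × ℝ => G (x, w)) (Icc (0:ℝ) 1 ×ˢ Icc 0 T) :=
    hG.comp (by fun_prop) fun w hw => ⟨hx', hw⟩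
  have hi : Integrable (fun w : ℝ × ℝ => G (x, w)) ((volume.restrict (Ioo (0:ℝ) 1)).prod
      (volume.restrict (Ioo 0 T))) := by
    rw [Measure.prod_restrict]
    exact (hGx.integrableOn_compact (isCompact_Icc.prod isCompact_Icc)).mono_set
      (prod_mono Ioo_subset_Icc_self Ioo_subset_Icc_self)
  have e1 : ∫ w in Ioo (0:ℝ) 1 ×ˢ Ioo 0 T, G (x, w)
      = ∫ t in Ioo 0 T, ∫ y in Ioo (0:ℝ) 1, G (x, y, t) := by
    rw [← integral_prod_symm _ hi, Measure.prod_restrict]; rfl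
  have e2 : T * C = ∫ t in Ioo 0 T, C := by simp [hT]
  rw [e1, e2, ← integral_neg]
  apply setIntegral_mono_on hi.integral_prod_right.neg (by simp) measurableSet_Ioo
  intro t ht
  have ht' := Ioo_subset_Icc_self ht
  have := setIntegral_Ioo_deriv zero_le_one (F := fun s => F (x, s, t)) (G := fun s => G (x, s, t))
    (fun y hy => hF x y t ⟨hx', hy, ht'⟩)
    (hG.comp (by fun_prop) fun y hy => ⟨hx', hy, ht'⟩)
  simp only [Pi.neg_apply]
  rw [this]
  linarith [hb x hx t ht]

lemma integrableOn_weight {α ε : ℝ} (hε : 0 < ε) :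
    IntegrableOn (fun y : ℝ => (1 - y + ε) ^ α) (Ioo 0 1) := by
  refine (ContinuousOn.integrableOn_compact (K := Icc (0:ℝ) 1) isCompact_Icc ?_).mono_set
    Ioo_subset_Icc_self
  refine ContinuousOn.rpow_const (by fun_prop) fun y hy => Or.inl ?_
  have := hy.2
  linarith

lemma hasDerivAt_weight {α ε y : ℝ} (hp : 0 < 1 - y + ε) :
    HasDerivAt (fun y => (1 - y + ε) ^ α) (-(α * (1 - y + ε) ^ (α - 1))) y := by
  refine ((((hasDerivAt_id y).const_sub 1).add_const ε).rpow_const (p := α)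
    (Or.inl hp.ne')).congr_deriv ?_
  simp

lemma integral_weight_le {α ε : ℝ} (hα : 0 < α) (hα1 : α ≤ 1) (hε : 0 < ε) (hε1 : ε ≤ 1) :
    ∫ y in Ioo (0:ℝ) 1, (1 - y + ε) ^ (α - 1) ≤ 2 / α := by
  rw [setIntegral_Ioo_deriv zero_le_one (F := fun y => -(1 - y + ε) ^ α / α)]
  · simp only [sub_self, zero_add, sub_zero]
    have h1 : (1 + ε) ^ α ≤ 2 := by
      calc (1 + ε) ^ α ≤ (1 + ε) ^ (1:ℝ) :=
            Real.rpow_le_rpow_of_exponent_le (by linarith) hα1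
        _ ≤ 2 := by rw [Real.rpow_one]; linarith
    have h2 : 0 ≤ ε ^ α := by positivity
    rw [← sub_div]
    gcongr
    linarith
  · intro y hy
    have hp : 0 < 1 - y + ε := by have := hy.2; linarith
    refine ((hasDerivAt_weight (α := α) hp).neg.div_const α).congr_deriv ?_
    field_simp
  · refine ContinuousOn.rpow_const (by fun_prop) fun y hy => Or.inl ?_
    have := hy.2
    linarith

theorem weighted_l1_transport_diffusion {L T α ε K K₀ D : ℝ} (hL : 0 ≤ L) (hT : 0 ≤ T)
    (hα : 0 < α) (hα1 : α ≤ 1) (hε : 0 < ε) (hε1 : ε ≤ 1) (hK : 0 ≤ K) (hK₀ : 0 ≤ K₀)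
    (hD : 0 ≤ D)
    {J Jx Jy Jt j jy jyy a ax b by' G : ℝ × ℝ × ℝ → ℝ}
    (cJ : ContinuousOn J (closedBox L T)) (cJx : ContinuousOn Jx (closedBox L T))
    (cJy : ContinuousOn Jy (closedBox L T)) (cJt : ContinuousOn Jt (closedBox L T))
    (cj : ContinuousOn j (closedBox L T))
    (cjyy : ContinuousOn jyy (closedBox L T))
    (ca : ContinuousOn a (closedBox L T)) (cax : ContinuousOn ax (closedBox L T))
    (cb : ContinuousOn b (closedBox L T)) (cby : ContinuousOn by' (closedBox L T))
    (cG : ContinuousOn G (closedBox L T))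
    (dJx : ∀ x y t, (x, y, t) ∈ closedBox L T → HasDerivAt (fun s => J (s, y, t)) (Jx (x, y, t)) x)
    (dJy : ∀ x y t, (x, y, t) ∈ closedBox L T → HasDerivAt (fun s => J (x, s, t)) (Jy (x, y, t)) y)
    (dJt : ∀ x y t, (x, y, t) ∈ closedBox L T → HasDerivAt (fun s => J (x, y, s)) (Jt (x, y, t)) t)
    (dj : ∀ x y t, (x, y, t) ∈ closedBox L T → HasDerivAt (fun s => j (x, s, t)) (jy (x, y, t)) y)
    (djy : ∀ x y t, (x, y, t) ∈ closedBox L T →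
      HasDerivAt (fun s => jy (x, s, t)) (jyy (x, y, t)) y)
    (da : ∀ x y t, (x, y, t) ∈ closedBox L T → HasDerivAt (fun s => a (s, y, t)) (ax (x, y, t)) x)
    (db : ∀ x y t, (x, y, t) ∈ closedBox L T → HasDerivAt (fun s => b (x, s, t)) (by' (x, y, t)) y)
    (hJ : ∀ p ∈ closedBox L T, 0 ≤ J p) (hj : ∀ p ∈ closedBox L T, 0 ≤ j p)
    (ha : ∀ p ∈ closedBox L T, 0 ≤ a p) (hG : ∀ p ∈ closedBox L T, 0 ≤ G p)
    (hab : ∀ p ∈ QT L T, ax p + by' p - α * b p / (1 - p.2.1 + ε) ≤ K)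
    (hin : ∀ p ∈ QT L T, Jt p + a p * Jx p + b p * Jy p - jyy p ≤ K₀ * J p + G p)
    (hx0 : ∀ y ∈ Ioo (0:ℝ) 1, ∀ t ∈ Ioo 0 T, a (0, y, t) * J (0, y, t) ≤ D / (1 - y + ε))
    (ht0 : ∀ x ∈ Ioo 0 L, ∀ y ∈ Ioo (0:ℝ) 1, J (x, y, 0) ≤ D / (1 - y + ε))
    (hy1 : ∀ x ∈ Ioo 0 L, ∀ t ∈ Ioo 0 T, jy (x, 1, t) = 0 ∧ b (x, 1, t) = 0 ∧
      α * ε ^ (α - 1) * j (x, 1, t) ≤ D)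
    (hy0 : ∀ x ∈ Ioo 0 L, ∀ t ∈ Ioo 0 T,
      b (x, 0, t) * J (x, 0, t) - jy (x, 0, t) ≤ D) :
    ∫ p in QT L T, (1 - p.2.1 + ε) ^ α * J p ≤ exp ((K + K₀ + 1) * T) *
      ((∫ p in QT L T, (1 - p.2.1 + ε) ^ α * G p) +
        D * (T * (2 / α) + L * (2 / α) + 3 * L * T)) := by
  set κ := K + K₀ + 1 with hκ
  have hκ0 : 0 ≤ κ := by positivity
  have hr : ∀ p ∈ closedBox L T, 0 < 1 - p.2.1 + ε := fun p hp => by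
    have := hp.2.1.2; linarith
  have cw : ∀ β : ℝ, ContinuousOn (fun p : ℝ × ℝ × ℝ => (1 - p.2.1 + ε) ^ β) (closedBox L T) :=
    fun β => ContinuousOn.rpow_const (by fun_prop) fun p hp => Or.inl (hr p hp).ne'
  have ce : ContinuousOn (fun p : ℝ × ℝ × ℝ => exp (-(κ * p.2.2))) (closedBox L T) := by fun_prop
  have cw0 := cw α
  have cw1 := cw (α - 1)
  have cw2 := cw (α - 1 - 1)
  set ψ : ℝ × ℝ × ℝ → ℝ := fun p => exp (-(κ * p.2.2)) * (1 - p.2.1 + ε) ^ α with hψ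
  have cψ : ContinuousOn ψ (closedBox L T) := ce.mul cw0
  set G1 : ℝ × ℝ × ℝ → ℝ := fun p => ψ p * (ax p * J p + a p * Jx p) with hG1
  set G2 : ℝ × ℝ × ℝ → ℝ := fun p => exp (-(κ * p.2.2)) *
    (-(α * (1 - p.2.1 + ε) ^ (α - 1)) * (b p * J p)
      + (1 - p.2.1 + ε) ^ α * (by' p * J p + b p * Jy p - jyy p)
      + α * (α - 1) * (1 - p.2.1 + ε) ^ (α - 1 - 1) * j p) with hG2
  set G3 : ℝ × ℝ × ℝ → ℝ := fun p => ψ p * (Jt p - κ * J p) with hG3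
  have cG1 : ContinuousOn G1 (closedBox L T) := by fun_prop
  have cG2 : ContinuousOn G2 (closedBox L T) := by fun_prop
  have cG3 : ContinuousOn G3 (closedBox L T) := by fun_prop
  have hDi : IntegrableOn (fun y : ℝ => D * (1 - y + ε) ^ (α - 1)) (Ioo 0 1) :=
    (integrableOn_weight hε).const_mul D
  have hDle : ∫ y in Ioo (0:ℝ) 1, D * (1 - y + ε) ^ (α - 1) ≤ D * (2 / α) := by
    rw [integral_const_mul]
    exact mul_le_mul_of_nonneg_left (integral_weight_le hα hα1 hε hε1) hD
  have hψ0 : ∀ p ∈ closedBox L T, 0 ≤ ψ p := fun p hp => by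
    have := hr p hp; positivity
  have hψ1 : ∀ p ∈ closedBox L T, ψ p ≤ (1 - p.2.1 + ε) ^ α := fun p hp => by
    have h1 := hr p hp
    have h2 : exp (-(κ * p.2.2)) ≤ 1 := by
      rw [Real.exp_le_one_iff]
      have := hp.2.2.1
      have := mul_nonneg hκ0 this
      linarith
    exact mul_le_of_le_one_left (by positivity) h2
  have hwD : ∀ y ∈ Ioo (0:ℝ) 1, ∀ X w : ℝ, 0 ≤ X → 0 ≤ w → w ≤ (1 - y + ε) ^ α →
      X ≤ D / (1 - y + ε) → w * X ≤ D * (1 - y + ε) ^ (α - 1) := by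
    intro y hy X w hX hw hw1 h
    have hp : 0 < 1 - y + ε := by have := hy.2; linarith
    calc w * X ≤ (1 - y + ε) ^ α * (D / (1 - y + ε)) := by gcongr
      _ = _ := by rw [Real.rpow_sub_one hp.ne']; ring
  have i1 : -∫ p in QT L T, G1 p ≤ T * (D * (2 / α)) := by
    refine (neg_integral_dx_le hL hT (F := fun p => ψ p * (a p * J p)) cG1 hDi ?_ ?_).trans
      (mul_le_mul_of_nonneg_left hDle hT)
    · intro x y t hp
      exact ((da x y t hp).mul (dJx x y t hp)).const_mul (ψ (x, y, t))
    · intro y hy t ht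
      have h0 : ((0:ℝ), y, t) ∈ closedBox L T :=
        ⟨⟨le_rfl, hL⟩, Ioo_subset_Icc_self hy, Ioo_subset_Icc_self ht⟩
      have hl : (L, y, t) ∈ closedBox L T :=
        ⟨⟨hL, le_rfl⟩, Ioo_subset_Icc_self hy, Ioo_subset_Icc_self ht⟩
      have h1 : 0 ≤ ψ (L, y, t) * (a (L, y, t) * J (L, y, t)) :=
        mul_nonneg (hψ0 _ hl) (mul_nonneg (ha _ hl) (hJ _ hl))
      have h2 := hwD y hy _ _ (mul_nonneg (ha _ h0) (hJ _ h0)) (hψ0 _ h0) (hψ1 _ h0) (hx0 y hy t ht)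
      linarith
  have i3 : -∫ p in QT L T, G3 p ≤ L * (D * (2 / α)) := by
    refine (neg_integral_dt_le hL hT (F := fun p => ψ p * J p) cG3 hDi ?_ ?_).trans
      (mul_le_mul_of_nonneg_left hDle hL)
    · intro x y t hp
      have h1 : HasDerivAt (fun s => ψ (x, y, s)) (-κ * ψ (x, y, t)) t := by
        refine (((hasDerivAt_id t).const_mul κ).neg.exp.mul_const ((1 - y + ε) ^ α)).congr_deriv ?_
        simp [hψ]; ring
      refine (h1.mul (dJt x y t hp)).congr_deriv ?_
      simp only [hG3]; ring
    · intro x hx y hy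
      have h0 : (x, y, (0:ℝ)) ∈ closedBox L T :=
        ⟨Ioo_subset_Icc_self hx, Ioo_subset_Icc_self hy, ⟨le_rfl, hT⟩⟩
      have hl : (x, y, T) ∈ closedBox L T :=
        ⟨Ioo_subset_Icc_self hx, Ioo_subset_Icc_self hy, ⟨hT, le_rfl⟩⟩
      have h1 : 0 ≤ ψ (x, y, T) * J (x, y, T) := mul_nonneg (hψ0 _ hl) (hJ _ hl)
      have h2 := hwD y hy _ _ (hJ _ h0) (hψ0 _ h0) (hψ1 _ h0) (ht0 x hx y hy)
      linarith
  have i2 : -∫ p in QT L T, G2 p ≤ L * (T * (3 * D)) := by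
    refine neg_integral_dy_le hL hT (F := fun p => exp (-(κ * p.2.2)) *
      ((1 - p.2.1 + ε) ^ α * (b p * J p - jy p) + -(α * (1 - p.2.1 + ε) ^ (α - 1)) * j p))
      cG2 ?_ ?_
    · intro x y t hp
      have hw0 := hasDerivAt_weight (α := α) (hr _ hp)
      have hw1 := ((hasDerivAt_weight (α := α - 1) (hr _ hp)).const_mul α).neg
      have h := ((hw0.mul (((db x y t hp).mul (dJy x y t hp)).sub (djy x y t hp))).add
        (hw1.mul (dj x y t hp))).const_mul (exp (-(κ * t)))
      refine h.congr_deriv ?_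
      simp only [hG2, Pi.mul_apply, Pi.sub_apply, Pi.neg_apply]; ring
    · intro x hx t ht
      have h0 : (x, (0:ℝ), t) ∈ closedBox L T :=
        ⟨Ioo_subset_Icc_self hx, ⟨le_rfl, zero_le_one⟩, Ioo_subset_Icc_self ht⟩
      have h1 : (x, (1:ℝ), t) ∈ closedBox L T :=
        ⟨Ioo_subset_Icc_self hx, ⟨zero_le_one, le_rfl⟩, Ioo_subset_Icc_self ht⟩
      obtain ⟨e1, e2, e3⟩ := hy1 x hx t ht
      have e0 := hy0 x hx t ht
      have w0 : 0 ≤ exp (-(κ * t)) := (exp_pos _).le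
      have w1 : exp (-(κ * t)) ≤ 1 := by
        rw [Real.exp_le_one_iff]
        have := mul_nonneg hκ0 ht.1.le
        linarith
      have r0 : (1 + ε) ^ α ≤ 2 := by
        calc (1 + ε) ^ α ≤ (1 + ε) ^ (1:ℝ) :=
              Real.rpow_le_rpow_of_exponent_le (by linarith) hα1
          _ ≤ 2 := by rw [Real.rpow_one]; linarith
      have r1 : 0 ≤ (1 + ε) ^ α := by positivity
      have m1 : (1 + ε) ^ α * (b (x, 0, t) * J (x, 0, t) - jy (x, 0, t)) ≤ 2 * D :=
        (mul_le_mul_of_nonneg_left e0 r1).trans (mul_le_mul_of_nonneg_right r0 hD)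
      have m2 : 0 ≤ α * (1 + ε) ^ (α - 1) * j (x, 0, t) := by
        have := hj _ h0; positivity
      have m3 : exp (-(κ * t)) * ((1 + ε) ^ α * (b (x, 0, t) * J (x, 0, t) - jy (x, 0, t))
          - α * (1 + ε) ^ (α - 1) * j (x, 0, t) + α * ε ^ (α - 1) * j (x, 1, t)) ≤ 3 * D :=
        (mul_le_mul_of_nonneg_left (by linarith) w0).trans
          (mul_le_of_le_one_left (by linarith) w1)
      simp only [e1, e2, sub_zero, zero_mul, mul_zero, zero_add, sub_self]
      linarith
  have ip : ∀ p ∈ QT L T, ψ p * J p ≤ (1 - p.2.1 + ε) ^ α * G p - (G1 p + G2 p + G3 p) := by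
    intro p hp
    have hp' := QT_subset_closedBox L T hp
    have h1 := hin p hp
    have h2 := hab p hp
    have hrp := hr p hp'
    have h3 : ψ p * (Jt p + a p * Jx p + b p * Jy p - jyy p) ≤ ψ p * (K₀ * J p + G p) :=
      mul_le_mul_of_nonneg_left h1 (hψ0 p hp')
    have h4 : ψ p * J p * (ax p + by' p - α * b p / (1 - p.2.1 + ε)) ≤ ψ p * J p * K :=
      mul_le_mul_of_nonneg_left h2 (mul_nonneg (hψ0 p hp') (hJ p hp'))
    have h5 : 0 ≤ exp (-(κ * p.2.2)) * (α * (1 - α) * (1 - p.2.1 + ε) ^ (α - 1 - 1) * j p) := by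
      have := hj p hp'
      have : 0 ≤ 1 - α := by linarith
      positivity
    have h6 : ψ p * G p ≤ (1 - p.2.1 + ε) ^ α * G p :=
      mul_le_mul_of_nonneg_right (hψ1 p hp') (hG p hp')
    have h7 : G1 p + G2 p + G3 p = ψ p * (Jt p + a p * Jx p + b p * Jy p - jyy p)
        + ψ p * J p * (ax p + by' p - α * b p / (1 - p.2.1 + ε)) - ψ p * J p * κ
        - exp (-(κ * p.2.2)) * (α * (1 - α) * (1 - p.2.1 + ε) ^ (α - 1 - 1) * j p) := by
      simp only [hG1, hG2, hG3, hψ]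
      rw [Real.rpow_sub_one hrp.ne' α]
      ring
    rw [h7, hκ]
    linarith
  have cGw : ContinuousOn (fun p : ℝ × ℝ × ℝ => (1 - p.2.1 + ε) ^ α * G p) (closedBox L T) := by
    fun_prop
  have cψJ : ContinuousOn (fun p : ℝ × ℝ × ℝ => ψ p * J p) (closedBox L T) := by
    fun_prop
  have cwJ : ContinuousOn (fun p : ℝ × ℝ × ℝ => (1 - p.2.1 + ε) ^ α * J p) (closedBox L T) := by
    fun_prop
  have I1 : ∫ p in QT L T, ψ p * J p ≤ (∫ p in QT L T, (1 - p.2.1 + ε) ^ α * G p) +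
      D * (T * (2 / α) + L * (2 / α) + 3 * L * T) := by
    have h := setIntegral_mono_on (integrableOn_QT cψJ)
      (integrableOn_QT (cGw.sub ((cG1.add cG2).add cG3))) (measurableSet_QT L T) ip
    have h' := integral_sub (integrableOn_QT cGw) (integrableOn_QT ((cG1.add cG2).add cG3))
    have h'' := integral_add (integrableOn_QT (cG1.add cG2)) (integrableOn_QT cG3)
    have h''' := integral_add (integrableOn_QT cG1) (integrableOn_QT cG2)
    simp only [Pi.add_apply] at h' h'' h'''
    simp only [Pi.add_apply, Pi.sub_apply] at h
    rw [h', h'', h'''] at h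
    linarith
  have I2 : ∫ p in QT L T, (1 - p.2.1 + ε) ^ α * J p ≤
      ∫ p in QT L T, exp (κ * T) * (ψ p * J p) := by
    refine setIntegral_mono_on (integrableOn_QT cwJ) (integrableOn_QT (cψJ.const_mul _))
      (measurableSet_QT L T) fun p hp => ?_
    have hp' := QT_subset_closedBox L T hp
    have h1 := hr p hp'
    have h2 := hJ p hp'
    have h3 : 1 ≤ exp (κ * T) * exp (-(κ * p.2.2)) := by
      rw [← Real.exp_add, Real.one_le_exp_iff]
      have := mul_le_mul_of_nonneg_left hp.2.2.2.le hκ0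
      linarith
    calc (1 - p.2.1 + ε) ^ α * J p
        ≤ (exp (κ * T) * exp (-(κ * p.2.2))) * ((1 - p.2.1 + ε) ^ α * J p) :=
          le_mul_of_one_le_left (by positivity) h3
      _ = _ := by simp only [hψ]; ring
  rw [integral_const_mul] at I2
  exact I2.trans (mul_le_mul_of_nonneg_left I1 (exp_pos _).le)

lemma hasDerivAt_sqrt_sq_add {f : ℝ → ℝ} {f' x δ : ℝ} (hδ : 0 < δ) (hf : HasDerivAt f f' x) :
    HasDerivAt (fun s => √(f s ^ 2 + δ ^ 2)) (f x * f' / √(f x ^ 2 + δ ^ 2)) x := by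
  have hp : f x ^ 2 + δ ^ 2 ≠ 0 := by positivity
  have h0 : √(f x ^ 2 + δ ^ 2) ≠ 0 := by positivity
  refine (((hf.pow 2).add_const (δ ^ 2)).sqrt hp).congr_deriv ?_
  simp only [Pi.pow_apply]
  field_simp
  push_cast
  ring

lemma hasDerivAt_sqrt_sq_add_div {f g : ℝ → ℝ} {f' g' x δ : ℝ} (hδ : 0 < δ)
    (hf : HasDerivAt f f' x) (hg : HasDerivAt g g' x) (h0 : g x ≠ 0) :
    HasDerivAt (fun s => √(f s ^ 2 + δ ^ 2) / g s ^ 2)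
      (f x * f' / √(f x ^ 2 + δ ^ 2) / g x ^ 2 - 2 * √(f x ^ 2 + δ ^ 2) * g' / g x ^ 3) x := by
  refine ((hasDerivAt_sqrt_sq_add hδ hf).div (hg.pow 2) (pow_ne_zero 2 h0)).congr_deriv ?_
  have hj : √(f x ^ 2 + δ ^ 2) ≠ 0 := by positivity
  simp only [Pi.pow_apply]
  field_simp
  push_cast
  ring

set_option maxHeartbeats 1000000 in
theorem weighted_l1_linearized {L T α ε K K₀ D : ℝ} (hL : 0 ≤ L) (hT : 0 ≤ T)
    (hα : 0 < α) (hα1 : α ≤ 1) (hε : 0 < ε) (hε1 : ε ≤ 1) (hK : 0 ≤ K) (hK₀ : 0 ≤ K₀)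
    (hD : 0 ≤ D)
    {s sx sy st z zx zy zt zyy a ax b by' G : ℝ × ℝ × ℝ → ℝ}
    (cs : ContinuousOn s (closedBox L T)) (csx : ContinuousOn sx (closedBox L T))
    (csy : ContinuousOn sy (closedBox L T)) (cst : ContinuousOn st (closedBox L T))
    (cz : ContinuousOn z (closedBox L T)) (czx : ContinuousOn zx (closedBox L T))
    (czy : ContinuousOn zy (closedBox L T)) (czt : ContinuousOn zt (closedBox L T))
    (czyy : ContinuousOn zyy (closedBox L T))
    (ca : ContinuousOn a (closedBox L T)) (cax : ContinuousOn ax (closedBox L T))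
    (cb : ContinuousOn b (closedBox L T)) (cby : ContinuousOn by' (closedBox L T))
    (cG : ContinuousOn G (closedBox L T))
    (dsx : ∀ x y t, (x, y, t) ∈ closedBox L T → HasDerivAt (fun w => s (w, y, t)) (sx (x, y, t)) x)
    (dsy : ∀ x y t, (x, y, t) ∈ closedBox L T → HasDerivAt (fun w => s (x, w, t)) (sy (x, y, t)) y)
    (dst : ∀ x y t, (x, y, t) ∈ closedBox L T → HasDerivAt (fun w => s (x, y, w)) (st (x, y, t)) t)
    (dzx : ∀ x y t, (x, y, t) ∈ closedBox L T → HasDerivAt (fun w => z (w, y, t)) (zx (x, y, t)) x)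
    (dzy : ∀ x y t, (x, y, t) ∈ closedBox L T → HasDerivAt (fun w => z (x, w, t)) (zy (x, y, t)) y)
    (dzt : ∀ x y t, (x, y, t) ∈ closedBox L T → HasDerivAt (fun w => z (x, y, w)) (zt (x, y, t)) t)
    (dzyy : ∀ x y t, (x, y, t) ∈ closedBox L T →
      HasDerivAt (fun w => zy (x, w, t)) (zyy (x, y, t)) y)
    (da : ∀ x y t, (x, y, t) ∈ closedBox L T → HasDerivAt (fun s => a (s, y, t)) (ax (x, y, t)) x)
    (db : ∀ x y t, (x, y, t) ∈ closedBox L T → HasDerivAt (fun s => b (x, s, t)) (by' (x, y, t)) y)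
    (hs : ∀ p ∈ closedBox L T, 0 < s p)
    (ha : ∀ p ∈ closedBox L T, 0 ≤ a p) (hG : ∀ p ∈ closedBox L T, 0 ≤ G p)
    (hab : ∀ p ∈ QT L T, ax p + by' p - α * b p / (1 - p.2.1 + ε) ≤ K)
    (hin : ∀ p ∈ QT L T, |(zt p + a p * zx p + b p * zy p) / s p ^ 2
      - 2 * z p * (st p + a p * sx p + b p * sy p) / s p ^ 3 - zyy p|
        ≤ K₀ * (|z p| / s p ^ 2) + G p)
    (hx0 : ∀ y ∈ Ioo (0:ℝ) 1, ∀ t ∈ Ioo 0 T,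
      a (0, y, t) * (|z (0, y, t)| / s (0, y, t) ^ 2) ≤ D / (1 - y + ε))
    (ht0 : ∀ x ∈ Ioo 0 L, ∀ y ∈ Ioo (0:ℝ) 1,
      |z (x, y, 0)| / s (x, y, 0) ^ 2 ≤ D / (1 - y + ε))
    (hy1 : ∀ x ∈ Ioo 0 L, ∀ t ∈ Ioo 0 T, z (x, 1, t) = 0 ∧ b (x, 1, t) = 0)
    (hy0 : ∀ x ∈ Ioo 0 L, ∀ t ∈ Ioo 0 T, 0 ≤ b (x, 0, t) ∧
      |zy (x, 0, t) - b (x, 0, t) * z (x, 0, t) / s (x, 0, t) ^ 2| ≤ D) :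
    ∫ p in QT L T, (1 - p.2.1 + ε) ^ α * (|z p| / s p ^ 2) ≤ exp ((K + K₀ + 1) * T) *
      ((∫ p in QT L T, (1 - p.2.1 + ε) ^ α * G p) +
        D * (T * (2 / α) + L * (2 / α) + 3 * L * T)) := by
  have hs0 : ∀ p ∈ closedBox L T, s p ≠ 0 := fun p hp => (hs p hp).ne'
  have hs2 : ∀ p ∈ closedBox L T, s p ^ 2 ≠ 0 := fun p hp => pow_ne_zero 2 (hs0 p hp)
  have hs3 : ∀ p ∈ closedBox L T, s p ^ 3 ≠ 0 := fun p hp => pow_ne_zero 3 (hs0 p hp)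
  have hr : ∀ p ∈ closedBox L T, 0 < 1 - p.2.1 + ε := fun p hp => by
    have := hp.2.1.2; linarith
  have hK' := isCompact_closedBox L T
  obtain ⟨E1, hE1⟩ := hK'.exists_bound_of_continuousOn
    (f := fun p => -2 * (st p + a p * sx p + b p * sy p) / s p ^ 3)
    (ContinuousOn.div (by fun_prop) (by fun_prop) hs3)
  obtain ⟨E2, hE2⟩ := hK'.exists_bound_of_continuousOn
    (f := fun p => a p / s p ^ 2) (ContinuousOn.div (by fun_prop) (by fun_prop) hs2)
  obtain ⟨E3, hE3⟩ := hK'.exists_bound_of_continuousOn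
    (f := fun p => 1 / s p ^ 2) (ContinuousOn.div (by fun_prop) (by fun_prop) hs2)
  obtain ⟨E4, hE4⟩ := hK'.exists_bound_of_continuousOn
    (f := fun p => b p / s p ^ 2) (ContinuousOn.div (by fun_prop) (by fun_prop) hs2)
  set E := |E1| + |E2| + |E3| + |E4| + α * ε ^ (α - 1) with hE
  have hE5 : 0 ≤ α * ε ^ (α - 1) := by positivity
  have hE0 : 0 ≤ E := by positivity
  have b1 : ∀ p ∈ closedBox L T, -2 * (st p + a p * sx p + b p * sy p) / s p ^ 3 ≤ E :=
    fun p hp => by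
      have h1 := (le_abs_self _).trans (hE1 p hp)
      have := le_abs_self E1
      have := abs_nonneg E2; have := abs_nonneg E3; have := abs_nonneg E4
      linarith
  have b2 : ∀ p ∈ closedBox L T, a p / s p ^ 2 ≤ E := fun p hp => by
      have h1 := (le_abs_self _).trans (hE2 p hp)
      have := le_abs_self E2
      have := abs_nonneg E1; have := abs_nonneg E3; have := abs_nonneg E4
      linarith
  have b3 : ∀ p ∈ closedBox L T, 1 / s p ^ 2 ≤ E := fun p hp => by
      have h1 := (le_abs_self _).trans (hE3 p hp)
      have := le_abs_self E3
      have := abs_nonneg E1; have := abs_nonneg E2; have := abs_nonneg E4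
      linarith
  have b4 : ∀ p ∈ closedBox L T, b p / s p ^ 2 ≤ E := fun p hp => by
      have h1 := (le_abs_self _).trans (hE4 p hp)
      have := le_abs_self E4
      have := abs_nonneg E1; have := abs_nonneg E2; have := abs_nonneg E3
      linarith
  have b5 : α * ε ^ (α - 1) ≤ E := by
      have := abs_nonneg E1; have := abs_nonneg E2; have := abs_nonneg E3; have := abs_nonneg E4
      linarith
  have cw : ContinuousOn (fun p : ℝ × ℝ × ℝ => (1 - p.2.1 + ε) ^ α) (closedBox L T) :=
    ContinuousOn.rpow_const (by fun_prop) fun p hp => Or.inl (hr p hp).ne'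
  set c₀ := T * (2 / α) + L * (2 / α) + 3 * L * T with hc₀
  have hc₀0 : 0 ≤ c₀ := by positivity
  set W := ∫ p in QT L T, (1 - p.2.1 + ε) ^ α with hW
  have hW0 : 0 ≤ W := setIntegral_nonneg (measurableSet_QT L T) fun p hp => by
    have := hr p (QT_subset_closedBox L T hp); positivity
  have cZ : ContinuousOn (fun p => (1 - p.2.1 + ε) ^ α * (|z p| / s p ^ 2)) (closedBox L T) :=
    cw.mul (ContinuousOn.div (by fun_prop) (by fun_prop) hs2)
  have key : ∀ δ > 0, ∫ p in QT L T, (1 - p.2.1 + ε) ^ α * (|z p| / s p ^ 2) ≤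
      exp ((K + K₀ + 1) * T) * ((∫ p in QT L T, (1 - p.2.1 + ε) ^ α * G p) + D * c₀)
      + δ * (exp ((K + K₀ + 1) * T) * (E * W + 2 * E * c₀)) := by
    intro δ hδ
    set j : ℝ × ℝ × ℝ → ℝ := fun p => √(z p ^ 2 + δ ^ 2) with hj
    have hj0 : ∀ p, 0 < j p := fun p => by simp only [hj]; positivity
    have hj0' : ∀ p, j p ≠ 0 := fun p => (hj0 p).ne'
    have hj2 : ∀ p, j p ^ 2 = z p ^ 2 + δ ^ 2 := fun p => Real.sq_sqrt (by positivity)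
    have hjδ : ∀ p, δ ≤ j p := fun p => Real.le_sqrt_of_sq_le (by nlinarith [sq_nonneg (z p)])
    have hjz : ∀ p, |z p| ≤ j p := fun p => Real.abs_le_sqrt (by nlinarith)
    have hjzδ : ∀ p, j p ≤ |z p| + δ := fun p => by
      refine Real.sqrt_le_iff.mpr ⟨by positivity, ?_⟩
      have := abs_nonneg (z p)
      nlinarith [sq_abs (z p)]
    have hdef0 : ∀ p, 0 ≤ δ ^ 2 / j p := fun p => by have := hj0 p; positivity
    have hdef : ∀ p, δ ^ 2 / j p ≤ δ := fun p => by
      rw [div_le_iff₀ (hj0 p), sq]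
      exact mul_le_mul_of_nonneg_left (hjδ p) hδ.le
    have hsgn : ∀ p, |z p / j p| ≤ 1 := fun p => by
      rw [abs_div, abs_of_pos (hj0 p), div_le_one (hj0 p)]; exact hjz p
    have cj : ContinuousOn j (closedBox L T) := by simp only [hj]; fun_prop
    have cE : ContinuousOn (fun p => G p + E * δ) (closedBox L T) := by fun_prop
    have hD' : 0 ≤ D + 2 * E * δ := by positivity
    have cJ' : ∀ f g : ℝ × ℝ × ℝ → ℝ, ContinuousOn f (closedBox L T) →
        ContinuousOn g (closedBox L T) →
        ContinuousOn (fun p => z p * f p / j p / s p ^ 2 - 2 * j p * g p / s p ^ 3)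
          (closedBox L T) := fun f g hf hg => by
      exact ((ContinuousOn.div (by fun_prop) cj fun p _ => hj0' p).div (by fun_prop) hs2).sub
        (ContinuousOn.div (by fun_prop) (by fun_prop) hs3)
    have hrD : ∀ y ∈ Ioo (0:ℝ) 1, E * δ ≤ 2 * E * δ / (1 - y + ε) := fun y hy => by
      have h1 : 0 < 1 - y + ε := by have := hy.2; linarith
      rw [le_div_iff₀ h1]
      have h2 : 1 - y + ε ≤ 2 := by have := hy.1; linarith
      have := mul_le_mul_of_nonneg_left h2 (mul_nonneg hE0 hδ.le)
      linarith
    have main := weighted_l1_transport_diffusion hL hT hα hα1 hε hε1 hK hK₀ hD'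
      (J := fun p => j p / s p ^ 2)
      (Jx := fun p => z p * zx p / j p / s p ^ 2 - 2 * j p * sx p / s p ^ 3)
      (Jy := fun p => z p * zy p / j p / s p ^ 2 - 2 * j p * sy p / s p ^ 3)
      (Jt := fun p => z p * zt p / j p / s p ^ 2 - 2 * j p * st p / s p ^ 3)
      (j := j) (jy := fun p => z p * zy p / j p)
      (jyy := fun p => z p * zyy p / j p + zy p ^ 2 * δ ^ 2 / j p ^ 3)
      (a := a) (ax := ax) (b := b) (by' := by') (G := fun p => G p + E * δ)
      (ContinuousOn.div cj (by fun_prop) hs2)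
      (cJ' _ _ czx csx) (cJ' _ _ czy csy) (cJ' _ _ czt cst) cj
      ((ContinuousOn.div (by fun_prop) cj fun p _ => hj0' p).add
        (ContinuousOn.div (by fun_prop) (by fun_prop) fun p _ => pow_ne_zero 3 (hj0' p)))
      ca cax cb cby cE
      (fun x y t hp => hasDerivAt_sqrt_sq_add_div hδ (dzx x y t hp) (dsx x y t hp) (hs0 _ hp))
      (fun x y t hp => hasDerivAt_sqrt_sq_add_div hδ (dzy x y t hp) (dsy x y t hp) (hs0 _ hp))
      (fun x y t hp => hasDerivAt_sqrt_sq_add_div hδ (dzt x y t hp) (dst x y t hp) (hs0 _ hp))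
      (fun x y t hp => hasDerivAt_sqrt_sq_add hδ (dzy x y t hp))
      ?_ da db
      (fun p hp => by have := hj0 p; have := hs p hp; positivity)
      (fun p _ => (hj0 p).le) ha
      (fun p hp => by have := hG p hp; positivity)
      hab ?_ ?_ ?_ ?_ ?_
    · have hJle : ∫ p in QT L T, (1 - p.2.1 + ε) ^ α * (|z p| / s p ^ 2) ≤
          ∫ p in QT L T, (1 - p.2.1 + ε) ^ α * (j p / s p ^ 2) := by
        refine setIntegral_mono_on (integrableOn_QT cZ)
          (integrableOn_QT (cw.mul (ContinuousOn.div cj (by fun_prop) hs2)))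
          (measurableSet_QT L T) fun p hp => ?_
        have h1 := hr p (QT_subset_closedBox L T hp)
        have h2 := hs p (QT_subset_closedBox L T hp)
        have h3 := hjz p
        gcongr
      refine (hJle.trans main).trans (le_of_eq ?_)
      have e1 : ∫ p in QT L T, (1 - p.2.1 + ε) ^ α * (G p + E * δ) =
          (∫ p in QT L T, (1 - p.2.1 + ε) ^ α * G p) + W * (E * δ) := by
        have h1 := integral_add (integrableOn_QT (cw.mul cG))
          (integrableOn_QT (cw.mul (continuousOn_const (c := E * δ))))
        simp only [Pi.mul_apply] at h1
        simp only [mul_add]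
        rw [h1, integral_mul_const]
      rw [e1]
      ring
    · intro x y t hp
      refine (((dzy x y t hp).mul (dzyy x y t hp)).div (hasDerivAt_sqrt_sq_add hδ (dzy x y t hp))
        (hj0' _)).congr_deriv ?_
      have h1 := hj2 (x, y, t)
      have h2 := hj0' (x, y, t)
      simp only [Pi.mul_apply]
      change ((zy (x, y, t) * zy (x, y, t) + z (x, y, t) * zyy (x, y, t)) * j (x, y, t)
        - z (x, y, t) * zy (x, y, t) * (z (x, y, t) * zy (x, y, t) / j (x, y, t)))
          / j (x, y, t) ^ 2 = _
      field_simp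
      linear_combination (zy (x, y, t)) ^ 2 * h1
    · intro p hp
      have hp' := QT_subset_closedBox L T hp
      have h0 := hj0 p
      have h0' := hj0' p
      have h1 := hj2 p
      have hsp := hs p hp'
      set R := (zt p + a p * zx p + b p * zy p) / s p ^ 2
        - 2 * z p * (st p + a p * sx p + b p * sy p) / s p ^ 3 - zyy p with hR
      have e : z p * zt p / j p / s p ^ 2 - 2 * j p * st p / s p ^ 3
          + a p * (z p * zx p / j p / s p ^ 2 - 2 * j p * sx p / s p ^ 3)
          + b p * (z p * zy p / j p / s p ^ 2 - 2 * j p * sy p / s p ^ 3)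
          - (z p * zyy p / j p + zy p ^ 2 * δ ^ 2 / j p ^ 3)
          = z p / j p * R
            + (-2 * (st p + a p * sx p + b p * sy p) / s p ^ 3) * (δ ^ 2 / j p)
            - zy p ^ 2 * δ ^ 2 / j p ^ 3 := by
        have hδ2 : δ ^ 2 = j p ^ 2 - z p ^ 2 := by rw [h1]; ring
        have h3 : δ ^ 2 / j p = j p - z p ^ 2 / j p := by rw [hδ2]; field_simp
        rw [h3, hR]
        ring
      have i1 : z p / j p * R ≤ |R| := by
        refine (le_abs_self _).trans ?_
        rw [abs_mul]
        exact mul_le_of_le_one_left (abs_nonneg _) (hsgn p)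
      have i2 : (-2 * (st p + a p * sx p + b p * sy p) / s p ^ 3) * (δ ^ 2 / j p) ≤ E * δ :=
        (mul_le_mul_of_nonneg_right (b1 p hp') (hdef0 p)).trans
          (mul_le_mul_of_nonneg_left (hdef p) hE0)
      have i3 : 0 ≤ zy p ^ 2 * δ ^ 2 / j p ^ 3 := by positivity
      have i4 : K₀ * (|z p| / s p ^ 2) ≤ K₀ * (j p / s p ^ 2) := by
        have := hjz p; gcongr
      have i5 := hin p hp
      rw [e]
      linarith
    · intro y hy t ht
      have h0 : ((0:ℝ), y, t) ∈ closedBox L T :=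
        ⟨⟨le_rfl, hL⟩, Ioo_subset_Icc_self hy, Ioo_subset_Icc_self ht⟩
      have h1 := hx0 y hy t ht
      have h2 : a (0, y, t) * (j (0, y, t) / s (0, y, t) ^ 2) ≤
          a (0, y, t) * ((|z (0, y, t)| + δ) / s (0, y, t) ^ 2) := by
        have := ha _ h0; have := hs _ h0; have := hjzδ (0, y, t); gcongr
      have h3 := mul_le_mul_of_nonneg_right (b2 _ h0) hδ.le
      have h4 := hrD y hy
      have h5 : a (0, y, t) * ((|z (0, y, t)| + δ) / s (0, y, t) ^ 2) =
        a (0, y, t) * (|z (0, y, t)| / s (0, y, t) ^ 2) + a (0, y, t) / s (0, y, t) ^ 2 * δ := by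
        ring
      rw [add_div]
      linarith
    · intro x hx y hy
      have h0 : (x, y, (0:ℝ)) ∈ closedBox L T :=
        ⟨Ioo_subset_Icc_self hx, Ioo_subset_Icc_self hy, ⟨le_rfl, hT⟩⟩
      have h1 := ht0 x hx y hy
      have h2 : j (x, y, 0) / s (x, y, 0) ^ 2 ≤ (|z (x, y, 0)| + δ) / s (x, y, 0) ^ 2 := by
        have := hs _ h0; have := hjzδ (x, y, 0); gcongr
      have h3 := mul_le_mul_of_nonneg_right (b3 _ h0) hδ.le
      have h4 := hrD y hy
      have h5 : (|z (x, y, 0)| + δ) / s (x, y, 0) ^ 2 =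
        |z (x, y, 0)| / s (x, y, 0) ^ 2 + 1 / s (x, y, 0) ^ 2 * δ := by
        ring
      rw [add_div]
      linarith
    · intro x hx t ht
      obtain ⟨h1, h2⟩ := hy1 x hx t ht
      refine ⟨by simp [h1], h2, ?_⟩
      have h3 := hjzδ (x, 1, t)
      rw [h1, abs_zero, zero_add] at h3
      have h4 : α * ε ^ (α - 1) * j (x, 1, t) ≤ E * δ :=
        mul_le_mul b5 h3 (hj0 _).le hE0
      have := mul_nonneg hE0 hδ.le
      linarith
    · intro x hx t ht
      have h0 : (x, (0:ℝ), t) ∈ closedBox L T :=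
        ⟨Ioo_subset_Icc_self hx, ⟨le_rfl, zero_le_one⟩, Ioo_subset_Icc_self ht⟩
      obtain ⟨hb0, h1⟩ := hy0 x hx t ht
      generalize ((x, (0:ℝ), t) : ℝ × ℝ × ℝ) = p at *
      have h2 := hj2 p
      have h3 := hj0' p
      have e : b p * (j p / s p ^ 2) - z p * zy p / j p =
          -(z p / j p) * (zy p - b p * z p / s p ^ 2) + b p / s p ^ 2 * (δ ^ 2 / j p) := by
        have hδ2 : δ ^ 2 = j p ^ 2 - z p ^ 2 := by rw [h2]; ring
        have h3 : δ ^ 2 / j p = j p - z p ^ 2 / j p := by rw [hδ2]; field_simp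
        rw [h3]
        ring
      have i1 : -(z p / j p) * (zy p - b p * z p / s p ^ 2) ≤ D := by
        refine ((le_abs_self _).trans ?_).trans h1
        rw [abs_mul, abs_neg]
        exact mul_le_of_le_one_left (abs_nonneg _) (hsgn p)
      have i2 : b p / s p ^ 2 * (δ ^ 2 / j p) ≤ E * δ :=
        (mul_le_mul_of_nonneg_right (b4 p h0) (hdef0 p)).trans
          (mul_le_mul_of_nonneg_left (hdef p) hE0)
      have := mul_nonneg hE0 hδ.le
      rw [e]
      linarith
  refine le_of_forall_pos_le_add fun η hη => ?_
  set Y := exp ((K + K₀ + 1) * T) * (E * W + 2 * E * c₀) with hY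
  have hY0 : 0 ≤ Y := by positivity
  refine (key (η / (Y + 1)) (by positivity)).trans ?_
  gcongr
  rw [div_mul_eq_mul_div, div_le_iff₀ (by positivity)]
  nlinarith

lemma integral_box_weight_le {L T α ε : ℝ} (hL : 0 ≤ L) (hT : 0 ≤ T)
    (hα : 0 < α) (hα1 : α ≤ 1) (hε : 0 < ε) (hε1 : ε ≤ 1) :
    ∫ p in QT L T, (1 - p.2.1 + ε) ^ (α - 1) ≤ L * T * (2 / α) := by
  have hr : ∀ p ∈ closedBox L T, 0 < 1 - p.2.1 + ε := fun p hp => by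
    have := hp.2.1.2; linarith
  have cw : ContinuousOn (fun p : ℝ × ℝ × ℝ => (1 - p.2.1 + ε) ^ (α - 1)) (closedBox L T) :=
    ContinuousOn.rpow_const (by fun_prop) fun p hp => Or.inl (hr p hp).ne'
  have h := neg_integral_dt_le hL hT
    (F := fun p : ℝ × ℝ × ℝ => -(1 - p.2.1 + ε) ^ (α - 1) * p.2.2)
    (G := fun p : ℝ × ℝ × ℝ => -(1 - p.2.1 + ε) ^ (α - 1))
    (B := fun y => T * (1 - y + ε) ^ (α - 1)) cw.neg
    ((integrableOn_weight hε).const_mul T)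
    (fun x y t _ => ((hasDerivAt_id t).const_mul (-(1 - y + ε) ^ (α - 1))).congr_deriv (by simp))
    (fun x _ y _ => le_of_eq (by simp only; ring))
  rw [integral_neg, neg_neg, integral_const_mul] at h
  refine h.trans ?_
  rw [mul_assoc]
  have := integral_weight_le hα hα1 hε hε1
  gcongr

theorem weighted_energy_bound {L T α ε N K D : ℝ} (hL : 0 ≤ L) (hT : 0 ≤ T)
    (hα : 0 < α) (hα1 : α < 1) (hε : 0 < ε) (hε1 : ε ≤ 1) (hN : 1 ≤ N) (hK : 0 ≤ K)
    (hD : 0 ≤ D)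
    {s sx sy st syy a ax b by' : ℝ × ℝ × ℝ → ℝ}
    (cs : ContinuousOn s (closedBox L T)) (csx : ContinuousOn sx (closedBox L T))
    (csy : ContinuousOn sy (closedBox L T)) (cst : ContinuousOn st (closedBox L T))
    (csyy : ContinuousOn syy (closedBox L T))
    (ca : ContinuousOn a (closedBox L T)) (cax : ContinuousOn ax (closedBox L T))
    (cb : ContinuousOn b (closedBox L T)) (cby : ContinuousOn by' (closedBox L T))
    (dsx : ∀ x y t, (x, y, t) ∈ closedBox L T → HasDerivAt (fun w => s (w, y, t)) (sx (x, y, t)) x)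
    (dsy : ∀ x y t, (x, y, t) ∈ closedBox L T → HasDerivAt (fun w => s (x, w, t)) (sy (x, y, t)) y)
    (dst : ∀ x y t, (x, y, t) ∈ closedBox L T → HasDerivAt (fun w => s (x, y, w)) (st (x, y, t)) t)
    (dsyy : ∀ x y t, (x, y, t) ∈ closedBox L T →
      HasDerivAt (fun w => sy (x, w, t)) (syy (x, y, t)) y)
    (da : ∀ x y t, (x, y, t) ∈ closedBox L T → HasDerivAt (fun s => a (s, y, t)) (ax (x, y, t)) x)
    (db : ∀ x y t, (x, y, t) ∈ closedBox L T → HasDerivAt (fun s => b (x, s, t)) (by' (x, y, t)) y)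
    (hs : ∀ p ∈ closedBox L T, (1 - p.2.1 + ε) / N ≤ s p ∧ s p ≤ N * (1 - p.2.1 + ε))
    (ha : ∀ p ∈ closedBox L T, 0 ≤ a p ∧ a p ≤ D)
    (hab : ∀ p ∈ QT L T, |ax p + by' p| ≤ K)
    (hin : ∀ p ∈ QT L T, |st p + a p * sx p + b p * sy p - s p ^ 2 * syy p| ≤ K * s p)
    (hy1 : ∀ x ∈ Ioo 0 L, ∀ t ∈ Ioo 0 T, sy (x, 1, t) ≤ 0 ∧ b (x, 1, t) = 0)
    (hy0 : ∀ x ∈ Ioo 0 L, ∀ t ∈ Ioo 0 T, 0 ≤ b (x, 0, t) ∧ -D ≤ sy (x, 0, t)) :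
    ∫ p in QT L T, (1 - p.2.1 + ε) ^ (α - 1) * sy p ^ 2 ≤
      N / α * (T * (D * N / (1 - α) * (2 / α)) + L * (N / (1 - α) * (2 / α)) + L * (T * (2 * N * D))
        + (K / (1 - α) + K) * N * (L * T * (2 / α))) := by
  have hN0 : 0 < N := by linarith
  have hβ : 0 < 1 - α := by linarith
  have hr : ∀ p ∈ closedBox L T, 0 < 1 - p.2.1 + ε := fun p hp => by
    have := hp.2.1.2; linarith
  have hs0 : ∀ p ∈ closedBox L T, 0 < s p := fun p hp =>
    (div_pos (hr p hp) hN0).trans_le (hs p hp).1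
  have cw : ContinuousOn (fun p : ℝ × ℝ × ℝ => (1 - p.2.1 + ε) ^ (α - 1)) (closedBox L T) :=
    ContinuousOn.rpow_const (by fun_prop) fun p hp => Or.inl (hr p hp).ne'
  have cS : ∀ β : ℝ, ContinuousOn (fun p => s p ^ β) (closedBox L T) := fun β =>
    ContinuousOn.rpow_const cs fun p hp => Or.inl (hs0 p hp).ne'
  have cS0 := cS α
  have cS1 := cS (α - 1)
  have cS2 := cS (α - 1 - 1)
  have hN1 : N ^ (1 - α) ≤ N := by
    calc N ^ (1 - α) ≤ N ^ (1:ℝ) := Real.rpow_le_rpow_of_exponent_le hN (by linarith)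
      _ = N := Real.rpow_one N
  have hup : ∀ p ∈ closedBox L T, s p ^ (α - 1) ≤ N * (1 - p.2.1 + ε) ^ (α - 1) := fun p hp => by
    have h1 := hr p hp
    calc s p ^ (α - 1) ≤ ((1 - p.2.1 + ε) / N) ^ (α - 1) :=
          Real.rpow_le_rpow_of_nonpos (by positivity) (hs p hp).1 (by linarith)
      _ = N ^ (1 - α) * (1 - p.2.1 + ε) ^ (α - 1) := by
          rw [Real.div_rpow h1.le hN0.le, show α - 1 = -(1 - α) by ring, Real.rpow_neg hN0.le]
          rw [div_inv_eq_mul, mul_comm]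
      _ ≤ _ := by gcongr
  have hlow : ∀ p ∈ closedBox L T, (1 - p.2.1 + ε) ^ (α - 1) ≤ N * s p ^ (α - 1) := fun p hp => by
    have h1 := hr p hp
    have h2 := hs0 p hp
    have h3 : (N * (1 - p.2.1 + ε)) ^ (α - 1) ≤ s p ^ (α - 1) :=
      Real.rpow_le_rpow_of_nonpos h2 (hs p hp).2 (by linarith)
    rw [Real.mul_rpow hN0.le h1.le] at h3
    calc (1 - p.2.1 + ε) ^ (α - 1)
        = N ^ (1 - α) * (N ^ (α - 1) * (1 - p.2.1 + ε) ^ (α - 1)) := by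
          rw [← mul_assoc, ← Real.rpow_add hN0]; simp
      _ ≤ N * s p ^ (α - 1) := by gcongr
  set G1 : ℝ × ℝ × ℝ → ℝ := fun p =>
    ax p * (-(s p ^ (α - 1) / (1 - α))) + a p * (s p ^ (α - 1 - 1) * sx p) with hG1
  set G2 : ℝ × ℝ × ℝ → ℝ := fun p =>
    by' p * (-(s p ^ (α - 1) / (1 - α))) + b p * (s p ^ (α - 1 - 1) * sy p)
      - (α * s p ^ (α - 1) * sy p ^ 2 + s p ^ α * syy p) with hG2
  set G3 : ℝ × ℝ × ℝ → ℝ := fun p => s p ^ (α - 1 - 1) * st p with hG3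
  have cG1 : ContinuousOn G1 (closedBox L T) := by fun_prop
  have cG2 : ContinuousOn G2 (closedBox L T) := by fun_prop
  have cG3 : ContinuousOn G3 (closedBox L T) := by fun_prop
  have dH : ∀ (f : ℝ → ℝ) (f' x : ℝ), HasDerivAt f f' x → 0 < f x →
      HasDerivAt (fun w => -(f w ^ (α - 1) / (1 - α))) (f x ^ (α - 1 - 1) * f') x := by
    intro f f' x hf h0
    refine ((hf.rpow_const (p := α - 1) (Or.inl h0.ne')).div_const (1 - α)).neg.congr_deriv ?_
    have := hβ.ne'
    field_simp
    ring
  have i1 : -∫ p in QT L T, G1 p ≤ T * (D * N / (1 - α) * (2 / α)) := by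
    refine (neg_integral_dx_le hL hT (F := fun p => a p * (-(s p ^ (α - 1) / (1 - α)))) cG1
      (B := fun y => D * N / (1 - α) * (1 - y + ε) ^ (α - 1))
      ((integrableOn_weight hε).const_mul _) ?_ ?_).trans ?_
    · intro x y t hp
      exact (da x y t hp).mul (dH _ _ _ (dsx x y t hp) (hs0 _ hp))
    · intro y hy t ht
      have h0 : ((0:ℝ), y, t) ∈ closedBox L T :=
        ⟨⟨le_rfl, hL⟩, Ioo_subset_Icc_self hy, Ioo_subset_Icc_self ht⟩
      have hl : (L, y, t) ∈ closedBox L T :=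
        ⟨⟨hL, le_rfl⟩, Ioo_subset_Icc_self hy, Ioo_subset_Icc_self ht⟩
      have h1 : 0 ≤ a (0, y, t) * (s (0, y, t) ^ (α - 1) / (1 - α)) := by
        have := (ha _ h0).1; have := hs0 _ h0; positivity
      have h2 : a (L, y, t) * (s (L, y, t) ^ (α - 1) / (1 - α)) ≤
          D * (N * (1 - y + ε) ^ (α - 1) / (1 - α)) := by
        have h4 := hup _ hl
        have h5 := (ha _ hl).2
        have := hs0 _ hl
        gcongr
      have h3 : D * N / (1 - α) * (1 - y + ε) ^ (α - 1) =
          D * (N * (1 - y + ε) ^ (α - 1) / (1 - α)) := by ring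
      rw [h3]
      linarith
    · rw [integral_const_mul]
      have := integral_weight_le hα hα1.le hε hε1
      gcongr
  have i3 : -∫ p in QT L T, G3 p ≤ L * (N / (1 - α) * (2 / α)) := by
    refine (neg_integral_dt_le hL hT (F := fun p => -(s p ^ (α - 1) / (1 - α))) cG3
      (B := fun y => N / (1 - α) * (1 - y + ε) ^ (α - 1))
      ((integrableOn_weight hε).const_mul _) ?_ ?_).trans ?_
    · intro x y t hp
      exact dH _ _ _ (dst x y t hp) (hs0 _ hp)
    · intro x hx y hy
      have h0 : (x, y, (0:ℝ)) ∈ closedBox L T :=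
        ⟨Ioo_subset_Icc_self hx, Ioo_subset_Icc_self hy, ⟨le_rfl, hT⟩⟩
      have hl : (x, y, T) ∈ closedBox L T :=
        ⟨Ioo_subset_Icc_self hx, Ioo_subset_Icc_self hy, ⟨hT, le_rfl⟩⟩
      have h1 : 0 ≤ s (x, y, 0) ^ (α - 1) / (1 - α) := by
        have := hs0 _ h0; positivity
      have h2 : s (x, y, T) ^ (α - 1) / (1 - α) ≤ N * (1 - y + ε) ^ (α - 1) / (1 - α) := by
        have h4 := hup _ hl
        gcongr
      have h3 : N / (1 - α) * (1 - y + ε) ^ (α - 1) =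
          N * (1 - y + ε) ^ (α - 1) / (1 - α) := by ring
      rw [h3]
      linarith
    · rw [integral_const_mul]
      have := integral_weight_le hα hα1.le hε hε1
      gcongr
  have i2 : -∫ p in QT L T, G2 p ≤ L * (T * (2 * N * D)) := by
    refine neg_integral_dy_le hL hT
      (F := fun p => b p * (-(s p ^ (α - 1) / (1 - α))) - s p ^ α * sy p) cG2 ?_ ?_
    · intro x y t hp
      refine (((db x y t hp).mul (dH _ _ _ (dsy x y t hp) (hs0 _ hp))).sub
        (((dsy x y t hp).rpow_const (p := α) (Or.inl (hs0 _ hp).ne')).mul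
          (dsyy x y t hp))).congr_deriv ?_
      simp only [hG2]
      ring
    · intro x hx t ht
      have h0 : (x, (0:ℝ), t) ∈ closedBox L T :=
        ⟨Ioo_subset_Icc_self hx, ⟨le_rfl, zero_le_one⟩, Ioo_subset_Icc_self ht⟩
      have h1 : (x, (1:ℝ), t) ∈ closedBox L T :=
        ⟨Ioo_subset_Icc_self hx, ⟨zero_le_one, le_rfl⟩, Ioo_subset_Icc_self ht⟩
      obtain ⟨e1, e2⟩ := hy1 x hx t ht
      obtain ⟨e3, e4⟩ := hy0 x hx t ht
      have h2 : 0 ≤ b (x, 0, t) * (s (x, 0, t) ^ (α - 1) / (1 - α)) := by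
        have := hs0 _ h0; positivity
      have h3 : 0 ≤ s (x, 1, t) ^ α * (-sy (x, 1, t)) := by
        have := hs0 _ h1
        have : 0 ≤ -sy (x, 1, t) := by linarith
        positivity
      have h4 : s (x, 0, t) ≤ 2 * N := by
        have := (hs _ h0).2
        simp only at this
        nlinarith
      have h5 : s (x, 0, t) ^ α ≤ 2 * N := by
        calc s (x, 0, t) ^ α ≤ (2 * N) ^ α := by have := (hs0 _ h0).le; gcongr
          _ ≤ (2 * N) ^ (1:ℝ) := Real.rpow_le_rpow_of_exponent_le (by linarith) hα1.le
          _ = 2 * N := Real.rpow_one _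
      have h6 : s (x, 0, t) ^ α * (-sy (x, 0, t)) ≤ 2 * N * D := by
        have h7 : 0 ≤ s (x, 0, t) ^ α := by have := hs0 _ h0; positivity
        calc s (x, 0, t) ^ α * (-sy (x, 0, t)) ≤ s (x, 0, t) ^ α * D :=
              mul_le_mul_of_nonneg_left (by linarith) h7
          _ ≤ _ := mul_le_mul_of_nonneg_right h5 hD
      rw [e2]
      linarith
  have cSw : ContinuousOn (fun p => s p ^ (α - 1) * sy p ^ 2) (closedBox L T) := by fun_prop
  have ip : ∀ p ∈ QT L T, (1 - p.2.1 + ε) ^ (α - 1) * sy p ^ 2 ≤ N / α *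
      ((K / (1 - α) + K) * N * (1 - p.2.1 + ε) ^ (α - 1) - (G1 p + G2 p + G3 p)) := by
    intro p hp
    have hp' := QT_subset_closedBox L T hp
    have hsp := hs0 p hp'
    have h1 := (abs_le.mp (hab p hp)).1
    have h2 := (abs_le.mp (hin p hp)).2
    have h3 := hup p hp'
    have h4 := hlow p hp'
    have e : α * s p ^ (α - 1) * sy p ^ 2 = s p ^ (α - 1 - 1) *
        (st p + a p * sx p + b p * sy p - s p ^ 2 * syy p)
        + (-(ax p + by' p)) * (s p ^ (α - 1) / (1 - α)) - (G1 p + G2 p + G3 p) := by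
      have e1 : s p ^ α = s p ^ (α - 1 - 1) * s p ^ 2 := by
        rw [Real.rpow_sub_one hsp.ne', Real.rpow_sub_one hsp.ne']; field_simp
      simp only [hG1, hG2, hG3]
      rw [e1]
      ring
    have i1 : s p ^ (α - 1 - 1) * (st p + a p * sx p + b p * sy p - s p ^ 2 * syy p) ≤
        K * s p ^ (α - 1) := by
      calc _ ≤ s p ^ (α - 1 - 1) * (K * s p) := by gcongr
        _ = _ := by rw [Real.rpow_sub_one hsp.ne' (α - 1)]; field_simp
    have i2 : (-(ax p + by' p)) * (s p ^ (α - 1) / (1 - α)) ≤ K * (s p ^ (α - 1) / (1 - α)) :=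
      mul_le_mul_of_nonneg_right (by linarith) (by positivity)
    have i3 : (K / (1 - α) + K) * s p ^ (α - 1) ≤
        (K / (1 - α) + K) * (N * (1 - p.2.1 + ε) ^ (α - 1)) :=
      mul_le_mul_of_nonneg_left h3 (by positivity)
    have i4 : α * s p ^ (α - 1) * sy p ^ 2 ≤
        (K / (1 - α) + K) * N * (1 - p.2.1 + ε) ^ (α - 1) - (G1 p + G2 p + G3 p) := by
      have : K * s p ^ (α - 1) + K * (s p ^ (α - 1) / (1 - α)) =
        (K / (1 - α) + K) * s p ^ (α - 1) := by ring
      linarith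
    calc (1 - p.2.1 + ε) ^ (α - 1) * sy p ^ 2 ≤ N * s p ^ (α - 1) * sy p ^ 2 := by gcongr
      _ = N / α * (α * s p ^ (α - 1) * sy p ^ 2) := by field_simp
      _ ≤ _ := by gcongr
  have cR : ContinuousOn (fun p : ℝ × ℝ × ℝ => (K / (1 - α) + K) * N * (1 - p.2.1 + ε) ^ (α - 1))
    (closedBox L T) := by fun_prop
  have h := setIntegral_mono_on
    (integrableOn_QT (f := fun p => (1 - p.2.1 + ε) ^ (α - 1) * sy p ^ 2) (by fun_prop))
    (integrableOn_QT (continuousOn_const.mul (cR.sub ((cG1.add cG2).add cG3))))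
    (measurableSet_QT L T) ip
  have h' := integral_sub (integrableOn_QT cR) (integrableOn_QT ((cG1.add cG2).add cG3))
  have h'' := integral_add (integrableOn_QT (cG1.add cG2)) (integrableOn_QT cG3)
  have h''' := integral_add (integrableOn_QT cG1) (integrableOn_QT cG2)
  simp only [Pi.add_apply] at h' h'' h'''
  simp only [Pi.add_apply, Pi.sub_apply, Pi.mul_apply] at h
  rw [integral_const_mul, h', h'', h''', integral_const_mul] at h
  refine h.trans ?_
  have hw := integral_box_weight_le (L := L) (T := T) hL hT hα hα1.le hε hε1
  have hw' : (K / (1 - α) + K) * N * ∫ p in QT L T, (1 - p.2.1 + ε) ^ (α - 1) ≤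
      (K / (1 - α) + K) * N * (L * T * (2 / α)) := by gcongr
  gcongr
  linarith

section PartialDerivatives

variable {E : Type*} [NormedAddCommGroup E] [NormedSpace ℝ E]

lemma contDiff_fderiv_apply {f : E → ℝ} (hf : ContDiff ℝ (⊤ : ℕ∞) f) (v : E) :
    ContDiff ℝ (⊤ : ℕ∞) (fun p => fderiv ℝ f p v) :=
  (hf.fderiv_right (m := (⊤ : ℕ∞)) (by norm_cast)).clm_apply contDiff_const

lemma fderiv_apply_comm {f : E → ℝ} (hf : ContDiff ℝ (⊤ : ℕ∞) f) (v w p : E) :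
    fderiv ℝ (fun q => fderiv ℝ f q v) p w = fderiv ℝ (fun q => fderiv ℝ f q w) p v := by
  have hd : DifferentiableAt ℝ (fderiv ℝ f) p :=
    ((hf.fderiv_right (m := (⊤ : ℕ∞)) (by norm_cast)).differentiable (by simp)) p
  have h : ∀ a : E, fderiv ℝ (fun q => fderiv ℝ f q a) p = (fderiv ℝ (fderiv ℝ f) p).flip a := by
    intro a
    have := (hd.hasFDerivAt.clm_apply (hasFDerivAt_const a p)).fderiv
    rw [this]
    ext b
    simp
  rw [h v, h w]
  exact (hf.contDiffAt.isSymmSndFDerivAt (by simpa using WithTop.coe_le_coe.2 (le_top (a := (2 : ℕ∞))))).eq w v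

lemma hasDerivAt_comp_affine {f : E → ℝ} (hf : ContDiff ℝ (⊤ : ℕ∞) f) {γ : ℝ → E} {v : E} {x : ℝ}
    (hγ : HasDerivAt γ v x) : HasDerivAt (fun s => f (γ s)) (fderiv ℝ f (γ x) v) x :=
  ((hf.differentiable (by simp)) (γ x)).hasFDerivAt.comp_hasDerivAt x hγ

end PartialDerivatives

lemma hasDerivAt_fst_line (x y t : ℝ) :
    HasDerivAt (fun s : ℝ => (s, y, t)) ((1, 0, 0) : ℝ × ℝ × ℝ) x :=
  (hasDerivAt_id x).prodMk ((hasDerivAt_const x y).prodMk (hasDerivAt_const x t))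

lemma hasDerivAt_snd_line (x y t : ℝ) :
    HasDerivAt (fun s : ℝ => (x, s, t)) ((0, 1, 0) : ℝ × ℝ × ℝ) y :=
  (hasDerivAt_const y x).prodMk ((hasDerivAt_id y).prodMk (hasDerivAt_const y t))

lemma hasDerivAt_thd_line (x y t : ℝ) :
    HasDerivAt (fun s : ℝ => (x, y, s)) ((0, 0, 1) : ℝ × ℝ × ℝ) t :=
  (hasDerivAt_const t x).prodMk ((hasDerivAt_const t y).prodMk (hasDerivAt_id t))

namespace Smooth3

variable {u : ℝ → ℝ → ℝ → ℝ}

lemma continuous (hu : Smooth3 u) : Continuous fun p : ℝ × ℝ × ℝ => u p.1 p.2.1 p.2.2 :=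
  ContDiff.continuous hu

lemma hasDerivAt_fderiv_x (hu : Smooth3 u) (x y t : ℝ) : HasDerivAt (fun s => u s y t)
    (fderiv ℝ (fun p : ℝ × ℝ × ℝ => u p.1 p.2.1 p.2.2) (x, y, t) (1, 0, 0)) x :=
  hasDerivAt_comp_affine hu (hasDerivAt_fst_line x y t)

lemma hasDerivAt_fderiv_y (hu : Smooth3 u) (x y t : ℝ) : HasDerivAt (fun s => u x s t)
    (fderiv ℝ (fun p : ℝ × ℝ × ℝ => u p.1 p.2.1 p.2.2) (x, y, t) (0, 1, 0)) y :=
  hasDerivAt_comp_affine hu (hasDerivAt_snd_line x y t)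

lemma hasDerivAt_fderiv_t (hu : Smooth3 u) (x y t : ℝ) : HasDerivAt (fun s => u x y s)
    (fderiv ℝ (fun p : ℝ × ℝ × ℝ => u p.1 p.2.1 p.2.2) (x, y, t) (0, 0, 1)) t :=
  hasDerivAt_comp_affine hu (hasDerivAt_thd_line x y t)

lemma Dx_eq (hu : Smooth3 u) : (fun p : ℝ × ℝ × ℝ => Dx u p.1 p.2.1 p.2.2) =
    fun p => fderiv ℝ (fun p : ℝ × ℝ × ℝ => u p.1 p.2.1 p.2.2) p (1, 0, 0) :=
  funext fun p => (hu.hasDerivAt_fderiv_x p.1 p.2.1 p.2.2).deriv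

lemma Dy_eq (hu : Smooth3 u) : (fun p : ℝ × ℝ × ℝ => Dy u p.1 p.2.1 p.2.2) =
    fun p => fderiv ℝ (fun p : ℝ × ℝ × ℝ => u p.1 p.2.1 p.2.2) p (0, 1, 0) :=
  funext fun p => (hu.hasDerivAt_fderiv_y p.1 p.2.1 p.2.2).deriv

lemma Dt_eq (hu : Smooth3 u) : (fun p : ℝ × ℝ × ℝ => Dt u p.1 p.2.1 p.2.2) =
    fun p => fderiv ℝ (fun p : ℝ × ℝ × ℝ => u p.1 p.2.1 p.2.2) p (0, 0, 1) :=
  funext fun p => (hu.hasDerivAt_fderiv_t p.1 p.2.1 p.2.2).deriv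

lemma dx (hu : Smooth3 u) : Smooth3 (Dx u) := by
  unfold Smooth3; rw [hu.Dx_eq]; exact contDiff_fderiv_apply hu _

lemma dy (hu : Smooth3 u) : Smooth3 (Dy u) := by
  unfold Smooth3; rw [hu.Dy_eq]; exact contDiff_fderiv_apply hu _

lemma dt (hu : Smooth3 u) : Smooth3 (Dt u) := by
  unfold Smooth3; rw [hu.Dt_eq]; exact contDiff_fderiv_apply hu _

lemma hasDerivAt_x (hu : Smooth3 u) (x y t : ℝ) :
    HasDerivAt (fun s => u s y t) (Dx u x y t) x :=
  (hu.hasDerivAt_fderiv_x x y t).differentiableAt.hasDerivAt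

lemma hasDerivAt_y (hu : Smooth3 u) (x y t : ℝ) :
    HasDerivAt (fun s => u x s t) (Dy u x y t) y :=
  (hu.hasDerivAt_fderiv_y x y t).differentiableAt.hasDerivAt

lemma hasDerivAt_t (hu : Smooth3 u) (x y t : ℝ) :
    HasDerivAt (fun s => u x y s) (Dt u x y t) t :=
  (hu.hasDerivAt_fderiv_t x y t).differentiableAt.hasDerivAt

lemma Dx_Dy (hu : Smooth3 u) : Dx (Dy u) = Dy (Dx u) := by
  funext x y t
  have h1 := congrFun hu.dy.Dx_eq (x, y, t)
  have h2 := congrFun hu.dx.Dy_eq (x, y, t)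
  rw [hu.Dy_eq] at h1
  rw [hu.Dx_eq] at h2
  exact h1.trans ((fderiv_apply_comm hu _ _ _).trans h2.symm)

lemma Dx_Dt (hu : Smooth3 u) : Dx (Dt u) = Dt (Dx u) := by
  funext x y t
  have h1 := congrFun hu.dt.Dx_eq (x, y, t)
  have h2 := congrFun hu.dx.Dt_eq (x, y, t)
  rw [hu.Dt_eq] at h1
  rw [hu.Dx_eq] at h2
  exact h1.trans ((fderiv_apply_comm hu _ _ _).trans h2.symm)

lemma Dt_Dy (hu : Smooth3 u) : Dt (Dy u) = Dy (Dt u) := by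
  funext x y t
  have h1 := congrFun hu.dy.Dt_eq (x, y, t)
  have h2 := congrFun hu.dt.Dy_eq (x, y, t)
  rw [hu.Dy_eq] at h1
  rw [hu.Dt_eq] at h2
  exact h1.trans ((fderiv_apply_comm hu _ _ _).trans h2.symm)

end Smooth3

lemma Dyy_eq (u : ℝ → ℝ → ℝ → ℝ) : Dyy u = Dy (Dy u) := by
  funext x y t
  unfold Dyy Dy
  rw [iteratedDeriv_succ, iteratedDeriv_one]

namespace Smooth2

variable {f : ℝ → ℝ → ℝ}

lemma continuous (hf : Smooth2 f) : Continuous fun p : ℝ × ℝ => f p.1 p.2 :=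
  ContDiff.continuous hf

lemma hasDerivAt_fderiv_fst (hf : Smooth2 f) (x t : ℝ) : HasDerivAt (fun s => f s t)
    (fderiv ℝ (fun p : ℝ × ℝ => f p.1 p.2) (x, t) (1, 0)) x :=
  hasDerivAt_comp_affine hf ((hasDerivAt_id x).prodMk (hasDerivAt_const x t))

lemma hasDerivAt_fderiv_snd (hf : Smooth2 f) (x t : ℝ) : HasDerivAt (fun s => f x s)
    (fderiv ℝ (fun p : ℝ × ℝ => f p.1 p.2) (x, t) (0, 1)) t :=
  hasDerivAt_comp_affine hf ((hasDerivAt_const t x).prodMk (hasDerivAt_id t))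

lemma pd1_eq (hf : Smooth2 f) : (fun p : ℝ × ℝ => pd1 f p.1 p.2) =
    fun p => fderiv ℝ (fun p : ℝ × ℝ => f p.1 p.2) p (1, 0) :=
  funext fun p => (hf.hasDerivAt_fderiv_fst p.1 p.2).deriv

lemma pd2_eq (hf : Smooth2 f) : (fun p : ℝ × ℝ => pd2 f p.1 p.2) =
    fun p => fderiv ℝ (fun p : ℝ × ℝ => f p.1 p.2) p (0, 1) :=
  funext fun p => (hf.hasDerivAt_fderiv_snd p.1 p.2).deriv

lemma smooth2_pd1 (hf : Smooth2 f) : Smooth2 (pd1 f) := by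
  unfold Smooth2; rw [hf.pd1_eq]; exact contDiff_fderiv_apply hf _

lemma smooth2_pd2 (hf : Smooth2 f) : Smooth2 (pd2 f) := by
  unfold Smooth2; rw [hf.pd2_eq]; exact contDiff_fderiv_apply hf _

lemma hasDerivAt_fst (hf : Smooth2 f) (x t : ℝ) : HasDerivAt (fun s => f s t) (pd1 f x t) x :=
  (hf.hasDerivAt_fderiv_fst x t).differentiableAt.hasDerivAt

lemma hasDerivAt_snd (hf : Smooth2 f) (x t : ℝ) : HasDerivAt (fun s => f x s) (pd2 f x t) t :=
  (hf.hasDerivAt_fderiv_snd x t).differentiableAt.hasDerivAt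

lemma pd1_pd2 (hf : Smooth2 f) : pd1 (pd2 f) = pd2 (pd1 f) := by
  funext x t
  have h1 := congrFun hf.smooth2_pd2.pd1_eq (x, t)
  have h2 := congrFun hf.smooth2_pd1.pd2_eq (x, t)
  rw [hf.pd2_eq] at h1
  rw [hf.pd1_eq] at h2
  exact h1.trans ((fderiv_apply_comm hf _ _ _).trans h2.symm)

end Smooth2

/-- The coefficient of `∂ₓu` as a function on space-time. -/
def coeffX (ε : ℝ) (U : ℝ → ℝ → ℝ) (q : ℝ × ℝ × ℝ) : ℝ := q.2.1 * U q.1 q.2.2 + ε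

/-- The coefficient of `∂_yu`, written in terms of `p = -∂ₓP/U`. -/
def coeffY (U p : ℝ → ℝ → ℝ) (q : ℝ × ℝ × ℝ) : ℝ :=
  (1 - q.2.1) * (q.2.1 * pd1 U q.1 q.2.2 + p q.1 q.2.2)

/-- The zeroth-order coefficient, written in terms of `p = -∂ₓP/U`. -/
def coeffZero (U p : ℝ → ℝ → ℝ) (q : ℝ × ℝ × ℝ) : ℝ :=
  (1 - q.2.1) * pd1 U q.1 q.2.2 + p q.1 q.2.2

/-- A solution of the regularized equation together with all the pointwise bounds on the data and
on the boundary values that enter the weighted estimates. -/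
structure FlowBounds (L T N ε : ℝ) (U p : ℝ → ℝ → ℝ) (u : ℝ → ℝ → ℝ → ℝ) : Prop where
  one_le : 1 ≤ N
  eps_pos : 0 < ε
  eps_le : ε ≤ 1
  smooth_U : Smooth2 U
  smooth_u : Smooth3 u
  cont_p : ContinuousOn (fun q : ℝ × ℝ => p q.1 q.2) (Icc 0 L ×ˢ Icc 0 T)
  deriv_p : ∀ x ∈ Icc 0 L, ∀ t ∈ Icc 0 T,
    HasDerivAt (fun s => p s t) (pd1 p x t) x ∧ HasDerivAt (fun s => p x s) (pd2 p x t) t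
  bound_U : ∀ x ∈ Icc 0 L, ∀ t ∈ Icc 0 T,
    0 ≤ U x t ∧ U x t ≤ N ∧ |pd1 U x t| ≤ N ∧ 0 ≤ p x t ∧ p x t ≤ N
  bound_dU : ∀ x ∈ Icc 0 L, ∀ t ∈ Icc 0 T, |pd1 (pd1 U) x t| ≤ N ∧ |pd2 (pd1 U) x t| ≤ N ∧
    |pd2 U x t| ≤ N ∧ |pd1 p x t| ≤ N ∧ |pd2 p x t| ≤ N
  bound_u : ∀ x ∈ Icc 0 L, ∀ y ∈ Icc (0:ℝ) 1, ∀ t ∈ Icc 0 T,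
    0 ≤ u x y t ∧ (1 - y + ε) / N ≤ u x y t + ε ∧ u x y t + ε ≤ N * (1 - y + ε)
  eq : ∀ x ∈ Icc 0 L, ∀ y ∈ Icc (0:ℝ) 1, ∀ t ∈ Icc 0 T,
    Dt u x y t - (u x y t + ε) ^ 2 * Dy (Dy u) x y t + coeffX ε U (x, y, t) * Dx u x y t
      + coeffY U p (x, y, t) * Dy u x y t + coeffZero U p (x, y, t) * u x y t = 0
  top : ∀ x ∈ Icc 0 L, ∀ t ∈ Icc 0 T, u x 1 t = 0
  bottom : ∀ x ∈ Ioo 0 L, ∀ t ∈ Ioo 0 T, |Dy u x 0 t| ≤ N ∧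
    |Dy (Dx u) x 0 t - p x t * Dx u x 0 t / (u x 0 t + ε) ^ 2| ≤ N ∧
    |Dy (Dt u) x 0 t - p x t * Dt u x 0 t / (u x 0 t + ε) ^ 2| ≤ N
  initial : ∀ x ∈ Ioo 0 L, ∀ y ∈ Ioo (0:ℝ) 1,
    |Dx u x y 0| ≤ N * (1 - y) ∧ |Dy u x y 0| ≤ N ∧ |Dy (Dy u) x y 0| ≤ N
  inflow : ∀ y ∈ Ioo (0:ℝ) 1, ∀ t ∈ Ioo 0 T,
    |Dt u 0 y t| ≤ N * (1 - y) ∧ |Dy u 0 y t| ≤ N ∧ |Dy (Dy u) 0 y t| ≤ N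

lemma linearized_residual_bound {N r s u z z' u' zyy uyy c bx cx uy w : ℝ} (hN : 1 ≤ N)
    (hr : 0 < r) (hs : r / N ≤ s) (hu : 0 ≤ u) (hus : u ≤ s) (hc : |c| ≤ 2 * N)
    (hbx : |bx| ≤ 2 * N * r) (hcx : |cx| ≤ 2 * N)
    (h0 : u' - s ^ 2 * uyy + c * u = 0)
    (h1 : z' - 2 * s * z * uyy - s ^ 2 * zyy + w + bx * uy + c * z + cx * u = 0) :
    |z' / s ^ 2 - 2 * z * u' / s ^ 3 - zyy| ≤
      2 * N * (|z| / s ^ 2) + |w| / s ^ 2 + 2 * N ^ 3 * (|uy| + 1) / r := by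
  have hN0 : 0 < N := by linarith
  have hs0 : 0 < s := (div_pos hr hN0).trans_le hs
  have hrs : r ≤ N * s := by rwa [div_le_iff₀' hN0] at hs
  have e : z' / s ^ 2 - 2 * z * u' / s ^ 3 - zyy =
      -(c * ((1 - 2 * u / s) * (z / s ^ 2)) + w / s ^ 2 + (bx * uy / s ^ 2 + cx * u / s ^ 2)) := by
    have hz' : z' = 2 * s * z * uyy + s ^ 2 * zyy - w - bx * uy - c * z - cx * u := by linarith
    have hu' : u' = s ^ 2 * uyy - c * u := by linarith
    rw [hz', hu']
    field_simp
    ring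
  have k1 : |1 - 2 * u / s| ≤ 1 := by
    rw [abs_le]
    have : u / s ≤ 1 := (div_le_one hs0).2 hus
    have : 0 ≤ u / s := by positivity
    have e : 2 * u / s = 2 * (u / s) := by ring
    rw [e]
    constructor <;> linarith
  have k2 : |c * ((1 - 2 * u / s) * (z / s ^ 2))| ≤ 2 * N * (|z| / s ^ 2) := by
    rw [abs_mul, abs_mul, abs_div, abs_of_pos (pow_pos hs0 2)]
    have : 0 ≤ |z| / s ^ 2 := by positivity
    calc |c| * (|1 - 2 * u / s| * (|z| / s ^ 2)) ≤ 2 * N * (1 * (|z| / s ^ 2)) := by gcongr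
      _ = _ := by ring
  have hs2 : r ^ 2 ≤ N ^ 2 * s ^ 2 := by rw [← mul_pow]; gcongr
  have k3 : |bx * uy / s ^ 2| ≤ 2 * N ^ 3 * |uy| / r := by
    rw [abs_div, abs_mul, abs_of_pos (pow_pos hs0 2), div_le_div_iff₀ (by positivity) hr]
    calc |bx| * |uy| * r ≤ 2 * N * r * |uy| * r := by gcongr
      _ = 2 * N * |uy| * r ^ 2 := by ring
      _ ≤ 2 * N * |uy| * (N ^ 2 * s ^ 2) := by gcongr
      _ = _ := by ring
  have k4 : |cx * u / s ^ 2| ≤ 2 * N ^ 3 / r := by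
    rw [abs_div, abs_mul, abs_of_pos (pow_pos hs0 2), abs_of_nonneg hu,
      div_le_div_iff₀ (by positivity) hr]
    calc |cx| * u * r ≤ 2 * N * s * (N * s) := by gcongr
      _ = 2 * N ^ 2 * s ^ 2 := by ring
      _ ≤ 2 * N ^ 3 * s ^ 2 := by gcongr; norm_num
  rw [e, abs_neg]
  have := abs_add_three (c * ((1 - 2 * u / s) * (z / s ^ 2))) (w / s ^ 2)
    (bx * uy / s ^ 2 + cx * u / s ^ 2)
  have := abs_add_le (bx * uy / s ^ 2) (cx * u / s ^ 2)
  have e2 : |w / s ^ 2| = |w| / s ^ 2 := by rw [abs_div, abs_of_pos (pow_pos hs0 2)]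
  have e3 : 2 * N ^ 3 * (|uy| + 1) / r = 2 * N ^ 3 * |uy| / r + 2 * N ^ 3 / r := by ring
  linarith

namespace FlowBounds

variable {L T N ε : ℝ} {U p : ℝ → ℝ → ℝ} {u : ℝ → ℝ → ℝ → ℝ}

lemma continuous_coeffX (h : FlowBounds L T N ε U p u) : Continuous (coeffX ε U) := by
  have := h.smooth_U.continuous.comp (by fun_prop : Continuous fun q : ℝ × ℝ × ℝ => (q.1, q.2.2))
  exact ((continuous_fst.comp continuous_snd).mul this).add continuous_const

lemma continuous_pd1 (h : FlowBounds L T N ε U p u) :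
    Continuous fun q : ℝ × ℝ × ℝ => pd1 U q.1 q.2.2 :=
  h.smooth_U.smooth2_pd1.continuous.comp
    (by fun_prop : Continuous fun q : ℝ × ℝ × ℝ => (q.1, q.2.2))

lemma continuousOn_p (h : FlowBounds L T N ε U p u) :
    ContinuousOn (fun q : ℝ × ℝ × ℝ => p q.1 q.2.2) (closedBox L T) :=
  h.cont_p.comp (f := fun q : ℝ × ℝ × ℝ => (q.1, q.2.2)) (by fun_prop) fun _ hq => ⟨hq.1, hq.2.2⟩

lemma continuousOn_coeffY (h : FlowBounds L T N ε U p u) :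
    ContinuousOn (coeffY U p) (closedBox L T) := by
  have h1 := h.continuous_pd1.continuousOn (s := closedBox L T)
  have h2 := h.continuousOn_p
  have h3 : ContinuousOn (fun q : ℝ × ℝ × ℝ => q.2.1) (closedBox L T) := by fun_prop
  exact (continuousOn_const.sub h3).mul ((h3.mul h1).add h2)

lemma hasDerivAt_coeffX (h : FlowBounds L T N ε U p u) (x y t : ℝ) :
    HasDerivAt (fun s => coeffX ε U (s, y, t)) (y * pd1 U x t) x :=
  ((h.smooth_U.hasDerivAt_fst x t).const_mul y).add_const ε

lemma hasDerivAt_coeffX_t (h : FlowBounds L T N ε U p u) (x y t : ℝ) :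
    HasDerivAt (fun s => coeffX ε U (x, y, s)) (y * pd2 U x t) t :=
  ((h.smooth_U.hasDerivAt_snd x t).const_mul y).add_const ε

lemma hasDerivAt_coeffY (x y t : ℝ) :
    HasDerivAt (fun s => coeffY U p (x, s, t))
      (-(y * pd1 U x t + p x t) + (1 - y) * pd1 U x t) y := by
  have := ((hasDerivAt_id y).const_sub 1).mul
    (((hasDerivAt_id y).mul_const (pd1 U x t)).add_const (p x t))
  refine this.congr_deriv ?_
  simp

lemma r_pos (h : FlowBounds L T N ε U p u) {q : ℝ × ℝ × ℝ} (hq : q ∈ closedBox L T) :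
    0 < 1 - q.2.1 + ε := by
  have := hq.2.1.2; have := h.eps_pos; linarith

lemma s_pos (h : FlowBounds L T N ε U p u) {q : ℝ × ℝ × ℝ} (hq : q ∈ closedBox L T) :
    0 < u q.1 q.2.1 q.2.2 + ε := by
  have := (h.bound_u q.1 hq.1 q.2.1 hq.2.1 q.2.2 hq.2.2).1; have := h.eps_pos; linarith

lemma coeffX_bounds (h : FlowBounds L T N ε U p u) {q : ℝ × ℝ × ℝ} (hq : q ∈ closedBox L T) :
    0 ≤ coeffX ε U q ∧ coeffX ε U q ≤ 2 * N := by
  obtain ⟨h1, h2, -⟩ := h.bound_U q.1 hq.1 q.2.2 hq.2.2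
  have := h.eps_pos; have := h.eps_le; have := h.one_le
  have := hq.2.1.1; have := hq.2.1.2
  unfold coeffX
  constructor
  · positivity
  · nlinarith

lemma abs_mul_le_of_mem {y k : ℝ} (hy : y ∈ Icc (0:ℝ) 1) : |y * k| ≤ |k| := by
  rw [abs_mul, abs_of_nonneg hy.1]
  exact mul_le_of_le_one_left (abs_nonneg _) hy.2

lemma abs_mul_add_le {y k l : ℝ} (hy : y ∈ Icc (0:ℝ) 1) (hk : |k| ≤ N) (hl : |l| ≤ N) :
    |y * k + l| ≤ 2 * N := by
  have := abs_mul_le_of_mem (k := k) hy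
  have := abs_add_le (y * k) l
  linarith

lemma one_sub_mem {y : ℝ} (hy : y ∈ Icc (0:ℝ) 1) : 1 - y ∈ Icc (0:ℝ) 1 :=
  ⟨by linarith [hy.2], by linarith [hy.1]⟩

lemma coeffY_bound (h : FlowBounds L T N ε U p u) {q : ℝ × ℝ × ℝ} (hq : q ∈ closedBox L T) :
    |coeffY U p q| ≤ 2 * N * (1 - q.2.1) := by
  obtain ⟨-, -, h1, h2, h3⟩ := h.bound_U q.1 hq.1 q.2.2 hq.2.2
  have := abs_mul_add_le (l := p q.1 q.2.2) hq.2.1 h1 (by rwa [abs_of_nonneg h2])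
  unfold coeffY
  have h0 := hq.2.1.2
  rw [abs_mul, abs_of_nonneg (by linarith)]
  have : 0 ≤ 1 - q.2.1 := by linarith
  nlinarith

lemma coeffZero_bound (h : FlowBounds L T N ε U p u) {q : ℝ × ℝ × ℝ} (hq : q ∈ closedBox L T) :
    |coeffZero U p q| ≤ 2 * N := by
  obtain ⟨-, -, h1, h2, h3⟩ := h.bound_U q.1 hq.1 q.2.2 hq.2.2
  exact abs_mul_add_le (one_sub_mem hq.2.1) h1 (by rwa [abs_of_nonneg h2])

lemma eq_x (h : FlowBounds L T N ε U p u) {x y t : ℝ} (hx : x ∈ Ioo 0 L) (hy : y ∈ Ioo (0:ℝ) 1)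
    (ht : t ∈ Ioo 0 T) :
    (Dt (Dx u) x y t + coeffX ε U (x, y, t) * Dx (Dx u) x y t
        + coeffY U p (x, y, t) * Dy (Dx u) x y t)
      - 2 * (u x y t + ε) * Dx u x y t * Dy (Dy u) x y t
      - (u x y t + ε) ^ 2 * Dy (Dy (Dx u)) x y t + y * pd1 U x t * Dx u x y t
      + (1 - y) * (y * pd1 (pd1 U) x t + pd1 p x t) * Dy u x y t
      + coeffZero U p (x, y, t) * Dx u x y t
      + ((1 - y) * pd1 (pd1 U) x t + pd1 p x t) * u x y t = 0 := by
  have hu := h.smooth_u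
  have hx' := Ioo_subset_Icc_self hx
  have hy' := Ioo_subset_Icc_self hy
  have ht' := Ioo_subset_Icc_self ht
  have hp := (h.deriv_p x hx' t ht').1
  have hk := h.smooth_U.smooth2_pd1.hasDerivAt_fst x t
  have hb : HasDerivAt (fun s => coeffY U p (s, y, t))
      ((1 - y) * (y * pd1 (pd1 U) x t + pd1 p x t)) x := ((hk.const_mul y).add hp).const_mul (1 - y)
  have hc : HasDerivAt (fun s => coeffZero U p (s, y, t))
      ((1 - y) * pd1 (pd1 U) x t + pd1 p x t) x := (hk.const_mul (1 - y)).add hp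
  have hd := ((((hu.dt.hasDerivAt_x x y t).sub ((((hu.hasDerivAt_x x y t).add_const ε).pow 2).mul
    (hu.dy.dy.hasDerivAt_x x y t))).add ((h.hasDerivAt_coeffX x y t).mul
    (hu.dx.hasDerivAt_x x y t))).add (hb.mul (hu.dy.hasDerivAt_x x y t))).add
    (hc.mul (hu.hasDerivAt_x x y t))
  have h0 := hd.unique ((hasDerivAt_const x (0:ℝ)).congr_of_eventuallyEq (by
    filter_upwards [isOpen_Ioo.mem_nhds hx] with s hs
    exact h.eq s (Ioo_subset_Icc_self hs) y hy' t ht'))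
  rw [hu.dy.Dx_Dy, hu.Dx_Dy, hu.Dx_Dt] at h0
  simp only [Nat.cast_ofNat, Pi.pow_apply] at h0
  linear_combination h0

lemma eq_t (h : FlowBounds L T N ε U p u) {x y t : ℝ} (hx : x ∈ Ioo 0 L) (hy : y ∈ Ioo (0:ℝ) 1)
    (ht : t ∈ Ioo 0 T) :
    (Dt (Dt u) x y t + coeffX ε U (x, y, t) * Dx (Dt u) x y t
        + coeffY U p (x, y, t) * Dy (Dt u) x y t)
      - 2 * (u x y t + ε) * Dt u x y t * Dy (Dy u) x y t
      - (u x y t + ε) ^ 2 * Dy (Dy (Dt u)) x y t + y * pd2 U x t * Dx u x y t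
      + (1 - y) * (y * pd2 (pd1 U) x t + pd2 p x t) * Dy u x y t
      + coeffZero U p (x, y, t) * Dt u x y t
      + ((1 - y) * pd2 (pd1 U) x t + pd2 p x t) * u x y t = 0 := by
  have hu := h.smooth_u
  have hx' := Ioo_subset_Icc_self hx
  have hy' := Ioo_subset_Icc_self hy
  have ht' := Ioo_subset_Icc_self ht
  have hp := (h.deriv_p x hx' t ht').2
  have hk := h.smooth_U.smooth2_pd1.hasDerivAt_snd x t
  have hb : HasDerivAt (fun s => coeffY U p (x, y, s))
      ((1 - y) * (y * pd2 (pd1 U) x t + pd2 p x t)) t := ((hk.const_mul y).add hp).const_mul (1 - y)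
  have hc : HasDerivAt (fun s => coeffZero U p (x, y, s))
      ((1 - y) * pd2 (pd1 U) x t + pd2 p x t) t := (hk.const_mul (1 - y)).add hp
  have hd := ((((hu.dt.hasDerivAt_t x y t).sub ((((hu.hasDerivAt_t x y t).add_const ε).pow 2).mul
    (hu.dy.dy.hasDerivAt_t x y t))).add ((h.hasDerivAt_coeffX_t x y t).mul
    (hu.dx.hasDerivAt_t x y t))).add (hb.mul (hu.dy.hasDerivAt_t x y t))).add
    (hc.mul (hu.hasDerivAt_t x y t))
  have h0 := hd.unique ((hasDerivAt_const t (0:ℝ)).congr_of_eventuallyEq (by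
    filter_upwards [isOpen_Ioo.mem_nhds ht] with s hs
    exact h.eq x hx' y hy' s (Ioo_subset_Icc_self hs)))
  rw [hu.dy.Dt_Dy, hu.Dt_Dy, ← hu.Dx_Dt] at h0
  simp only [Nat.cast_ofNat, Pi.pow_apply] at h0
  linear_combination h0

lemma top_eq_zero (h : FlowBounds L T N ε U p u) {x t : ℝ} (hx : x ∈ Ioo 0 L) (ht : t ∈ Ioo 0 T) :
    Dx u x 1 t = 0 ∧ Dt u x 1 t = 0 := by
  constructor
  · exact (h.smooth_u.hasDerivAt_x x 1 t).unique ((hasDerivAt_const x (0:ℝ)).congr_of_eventuallyEq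
      (by filter_upwards [isOpen_Ioo.mem_nhds hx] with s hs
          exact h.top s (Ioo_subset_Icc_self hs) t (Ioo_subset_Icc_self ht)))
  · exact (h.smooth_u.hasDerivAt_t x 1 t).unique ((hasDerivAt_const t (0:ℝ)).congr_of_eventuallyEq
      (by filter_upwards [isOpen_Ioo.mem_nhds ht] with s hs
          exact h.top x (Ioo_subset_Icc_self hx) s (Ioo_subset_Icc_self hs)))

lemma Dy_top_nonpos (h : FlowBounds L T N ε U p u) {x t : ℝ} (hx : x ∈ Icc 0 L)
    (ht : t ∈ Icc 0 T) : Dy u x 1 t ≤ 0 := by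
  have hd := (h.smooth_u.hasDerivAt_y x 1 t).hasDerivWithinAt (s := Iio 1)
  rw [hasDerivWithinAt_iff_tendsto_slope' (by simp)] at hd
  refine le_of_tendsto hd ?_
  filter_upwards [Ioo_mem_nhdsLT (show (0:ℝ) < 1 by norm_num)] with y hy
  rw [slope_def_field, h.top x hx t ht]
  have := (h.bound_u x hx y (Ioo_subset_Icc_self hy) t ht).1
  exact div_nonpos_of_nonneg_of_nonpos (by linarith) (by linarith [hy.2])

end FlowBounds

lemma boundary_div_sq_le {N r s v w : ℝ} (hN : 1 ≤ N) (hr : 0 < r) (hr2 : r ≤ 2)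
    (hs : r / N ≤ s) (hw : |w| ≤ N) (hv : |v - s ^ 2 * w| ≤ 6 * N ^ 2 * r) :
    |v| / s ^ 2 ≤ 8 * N ^ 4 / r := by
  have hN0 : 0 < N := by linarith
  have hs0 : 0 < s := (div_pos hr hN0).trans_le hs
  have hrs : r ≤ N * s := by rwa [div_le_iff₀' hN0] at hs
  have hs2 : r ^ 2 ≤ N ^ 2 * s ^ 2 := by rw [← mul_pow]; gcongr
  have h1 : |v| ≤ |v - s ^ 2 * w| + s ^ 2 * |w| := by
    have := abs_add_le (v - s ^ 2 * w) (s ^ 2 * w)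
    rw [abs_mul, abs_of_pos (pow_pos hs0 2), sub_add_cancel] at this
    exact this
  rw [div_le_div_iff₀ (by positivity) hr]
  have h2 : N ≤ N ^ 4 := le_self_pow₀ hN (by norm_num)
  calc |v| * r ≤ (6 * N ^ 2 * r + s ^ 2 * N) * r := by
        gcongr
        exact h1.trans (by gcongr)
    _ = 6 * N ^ 2 * r ^ 2 + s ^ 2 * N * r := by ring
    _ ≤ 6 * N ^ 2 * (N ^ 2 * s ^ 2) + s ^ 2 * N ^ 4 * 2 := by gcongr
    _ = 8 * N ^ 4 * s ^ 2 := by ring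

namespace FlowBounds

variable {L T N ε α : ℝ} {U p : ℝ → ℝ → ℝ} {u z : ℝ → ℝ → ℝ → ℝ} {G : ℝ × ℝ × ℝ → ℝ}

lemma continuousOn_div_r (h : FlowBounds L T N ε U p u) {f : ℝ × ℝ × ℝ → ℝ}
    (hf : ContinuousOn f (closedBox L T)) :
    ContinuousOn (fun q => f q / (1 - q.2.1 + ε)) (closedBox L T) :=
  hf.div (by fun_prop) fun _ hq => (h.r_pos hq).ne'

lemma continuousOn_weight (h : FlowBounds L T N ε U p u) (β : ℝ) :
    ContinuousOn (fun q : ℝ × ℝ × ℝ => (1 - q.2.1 + ε) ^ β) (closedBox L T) :=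
  ContinuousOn.rpow_const (by fun_prop) fun _ hq => Or.inl (h.r_pos hq).ne'

lemma continuousOn_div_sq (h : FlowBounds L T N ε U p u) (hz : Smooth3 z) :
    ContinuousOn (fun q : ℝ × ℝ × ℝ =>
      |z q.1 q.2.1 q.2.2| / (u q.1 q.2.1 q.2.2 + ε) ^ 2) (closedBox L T) :=
  hz.continuous.abs.continuousOn.div
    ((h.smooth_u.continuous.add continuous_const).pow 2).continuousOn
    fun _ hq => (pow_pos (h.s_pos hq) 2).ne'

lemma continuousOn_deriv_coeffX (h : FlowBounds L T N ε U p u) :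
    ContinuousOn (fun q : ℝ × ℝ × ℝ => q.2.1 * pd1 U q.1 q.2.2) (closedBox L T) :=
  ((continuous_fst.comp continuous_snd).mul h.continuous_pd1).continuousOn

lemma continuousOn_deriv_coeffY (h : FlowBounds L T N ε U p u) :
    ContinuousOn (fun q : ℝ × ℝ × ℝ => -(q.2.1 * pd1 U q.1 q.2.2 + p q.1 q.2.2)
      + (1 - q.2.1) * pd1 U q.1 q.2.2) (closedBox L T) :=
  (h.continuousOn_deriv_coeffX.add h.continuousOn_p).neg.add
    ((by fun_prop : ContinuousOn (fun q : ℝ × ℝ × ℝ => 1 - q.2.1) (closedBox L T)).mul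
      h.continuous_pd1.continuousOn)

lemma divergence_bound (h : FlowBounds L T N ε U p u) {q : ℝ × ℝ × ℝ} (hq : q ∈ closedBox L T) :
    |q.2.1 * pd1 U q.1 q.2.2 + (-(q.2.1 * pd1 U q.1 q.2.2 + p q.1 q.2.2)
      + (1 - q.2.1) * pd1 U q.1 q.2.2)| ≤ 2 * N := by
  obtain ⟨-, -, h1, h2, h3⟩ := h.bound_U q.1 hq.1 q.2.2 hq.2.2
  have := abs_mul_add_le (l := -p q.1 q.2.2) (one_sub_mem hq.2.1) h1
    (by rwa [abs_neg, abs_of_nonneg h2])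
  convert this using 2
  ring

theorem integral_mul_sq_deriv_y_le (h : FlowBounds L T N ε U p u) (hL : 0 ≤ L) (hT : 0 ≤ T)
    (hα : 0 < α) (hα1 : α < 1) :
    ∫ q in QT L T, (1 - q.2.1 + ε) ^ (α - 1) * Dy u q.1 q.2.1 q.2.2 ^ 2 ≤
      N / α * (T * (2 * N * N / (1 - α) * (2 / α)) + L * (N / (1 - α) * (2 / α))
        + L * (T * (2 * N * (2 * N)))
        + (2 * N / (1 - α) + 2 * N) * N * (L * T * (2 / α))) := by
  have hN := h.one_le
  have hu := h.smooth_u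
  refine weighted_energy_bound (K := 2 * N) (D := 2 * N) hL hT hα hα1 h.eps_pos h.eps_le hN
    (by linarith) (by linarith)
    (s := fun q => u q.1 q.2.1 q.2.2 + ε) (sx := fun q => Dx u q.1 q.2.1 q.2.2)
    (sy := fun q => Dy u q.1 q.2.1 q.2.2) (st := fun q => Dt u q.1 q.2.1 q.2.2)
    (syy := fun q => Dy (Dy u) q.1 q.2.1 q.2.2)
    (a := coeffX ε U) (b := coeffY U p)
    (hu.continuous.add continuous_const).continuousOn hu.dx.continuous.continuousOn
    hu.dy.continuous.continuousOn hu.dt.continuous.continuousOn hu.dy.dy.continuous.continuousOn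
    h.continuous_coeffX.continuousOn h.continuousOn_deriv_coeffX h.continuousOn_coeffY
    h.continuousOn_deriv_coeffY
    (fun x y t _ => (hu.hasDerivAt_x x y t).add_const ε)
    (fun x y t _ => (hu.hasDerivAt_y x y t).add_const ε)
    (fun x y t _ => (hu.hasDerivAt_t x y t).add_const ε)
    (fun x y t _ => hu.dy.hasDerivAt_y x y t)
    (fun x y t _ => h.hasDerivAt_coeffX x y t) (fun x y t _ => hasDerivAt_coeffY x y t)
    (fun q hq => (h.bound_u q.1 hq.1 q.2.1 hq.2.1 q.2.2 hq.2.2).2)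
    (fun q hq => h.coeffX_bounds hq)
    (fun q hq => h.divergence_bound (QT_subset_closedBox L T hq)) ?_ ?_ ?_
  · intro q hq
    have hq' := QT_subset_closedBox L T hq
    have e := h.eq q.1 hq'.1 q.2.1 hq'.2.1 q.2.2 hq'.2.2
    have hc := h.coeffZero_bound hq'
    have hu0 := (h.bound_u q.1 hq'.1 q.2.1 hq'.2.1 q.2.2 hq'.2.2).1
    have hε := h.eps_pos
    have e' : Dt u q.1 q.2.1 q.2.2 + coeffX ε U q * Dx u q.1 q.2.1 q.2.2
        + coeffY U p q * Dy u q.1 q.2.1 q.2.2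
        - (u q.1 q.2.1 q.2.2 + ε) ^ 2 * Dy (Dy u) q.1 q.2.1 q.2.2
        = -(coeffZero U p q * u q.1 q.2.1 q.2.2) := by
      linear_combination e
    rw [e', abs_neg, abs_mul, abs_of_nonneg hu0]
    gcongr
    linarith
  · intro x hx t ht
    exact ⟨h.Dy_top_nonpos (Ioo_subset_Icc_self hx) (Ioo_subset_Icc_self ht), by simp [coeffY]⟩
  · intro x hx t ht
    have h1 := h.bound_U x (Ioo_subset_Icc_self hx) t (Ioo_subset_Icc_self ht)
    have h2 := abs_le.1 (h.bottom x hx t ht).1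
    refine ⟨by simpa [coeffY] using h1.2.2.2.1, ?_⟩
    simp only
    linarith [h2.1]

theorem integral_mul_deriv_div_sq_le (h : FlowBounds L T N ε U p u) (hL : 0 ≤ L) (hT : 0 ≤ T)
    (hα : 0 < α) (hα1 : α ≤ 1) (hz : Smooth3 z) (cG : ContinuousOn G (closedBox L T))
    (hG : ∀ q ∈ closedBox L T, 0 ≤ G q)
    (hin : ∀ q ∈ QT L T, |(Dt z q.1 q.2.1 q.2.2 + coeffX ε U q * Dx z q.1 q.2.1 q.2.2
        + coeffY U p q * Dy z q.1 q.2.1 q.2.2) / (u q.1 q.2.1 q.2.2 + ε) ^ 2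
      - 2 * z q.1 q.2.1 q.2.2 * (Dt u q.1 q.2.1 q.2.2 + coeffX ε U q * Dx u q.1 q.2.1 q.2.2
        + coeffY U p q * Dy u q.1 q.2.1 q.2.2) / (u q.1 q.2.1 q.2.2 + ε) ^ 3
      - Dy (Dy z) q.1 q.2.1 q.2.2| ≤
        3 * N * (|z q.1 q.2.1 q.2.2| / (u q.1 q.2.1 q.2.2 + ε) ^ 2) + G q)
    (hx0 : ∀ y ∈ Ioo (0:ℝ) 1, ∀ t ∈ Ioo 0 T,
      |coeffX ε U (0, y, t) * z 0 y t| / (u 0 y t + ε) ^ 2 ≤ 8 * N ^ 4 / (1 - y + ε))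
    (ht0 : ∀ x ∈ Ioo 0 L, ∀ y ∈ Ioo (0:ℝ) 1,
      |z x y 0| / (u x y 0 + ε) ^ 2 ≤ 8 * N ^ 4 / (1 - y + ε))
    (hy1 : ∀ x ∈ Ioo 0 L, ∀ t ∈ Ioo 0 T, z x 1 t = 0)
    (hy0 : ∀ x ∈ Ioo 0 L, ∀ t ∈ Ioo 0 T,
      |Dy z x 0 t - p x t * z x 0 t / (u x 0 t + ε) ^ 2| ≤ N) :
    ∫ q in QT L T, (1 - q.2.1 + ε) ^ α * (|z q.1 q.2.1 q.2.2| / (u q.1 q.2.1 q.2.2 + ε) ^ 2) ≤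
      exp ((6 * N + 3 * N + 1) * T) * ((∫ q in QT L T, (1 - q.2.1 + ε) ^ α * G q) +
        8 * N ^ 4 * (T * (2 / α) + L * (2 / α) + 3 * L * T)) := by
  have hN := h.one_le
  have hu := h.smooth_u
  refine weighted_l1_linearized (K := 6 * N) (K₀ := 3 * N) (D := 8 * N ^ 4) hL hT hα hα1
    h.eps_pos h.eps_le (by linarith) (by linarith) (by positivity)
    (s := fun q => u q.1 q.2.1 q.2.2 + ε) (sx := fun q => Dx u q.1 q.2.1 q.2.2)
    (sy := fun q => Dy u q.1 q.2.1 q.2.2) (st := fun q => Dt u q.1 q.2.1 q.2.2)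
    (z := fun q => z q.1 q.2.1 q.2.2) (zx := fun q => Dx z q.1 q.2.1 q.2.2)
    (zy := fun q => Dy z q.1 q.2.1 q.2.2) (zt := fun q => Dt z q.1 q.2.1 q.2.2)
    (zyy := fun q => Dy (Dy z) q.1 q.2.1 q.2.2)
    (a := coeffX ε U) (b := coeffY U p)
    (hu.continuous.add continuous_const).continuousOn hu.dx.continuous.continuousOn
    hu.dy.continuous.continuousOn hu.dt.continuous.continuousOn
    hz.continuous.continuousOn hz.dx.continuous.continuousOn
    hz.dy.continuous.continuousOn hz.dt.continuous.continuousOn hz.dy.dy.continuous.continuousOn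
    h.continuous_coeffX.continuousOn h.continuousOn_deriv_coeffX h.continuousOn_coeffY
    h.continuousOn_deriv_coeffY cG
    (fun x y t _ => (hu.hasDerivAt_x x y t).add_const ε)
    (fun x y t _ => (hu.hasDerivAt_y x y t).add_const ε)
    (fun x y t _ => (hu.hasDerivAt_t x y t).add_const ε)
    (fun x y t _ => hz.hasDerivAt_x x y t) (fun x y t _ => hz.hasDerivAt_y x y t)
    (fun x y t _ => hz.hasDerivAt_t x y t) (fun x y t _ => hz.dy.hasDerivAt_y x y t)
    (fun x y t _ => h.hasDerivAt_coeffX x y t) (fun x y t _ => hasDerivAt_coeffY x y t)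
    (fun q hq => h.s_pos hq) (fun q hq => (h.coeffX_bounds hq).1) hG ?_ hin ?_ ht0 ?_ ?_
  · intro q hq
    have hq' := QT_subset_closedBox L T hq
    have h1 := (abs_le.1 (h.divergence_bound hq')).2
    have h2 := h.coeffY_bound hq'
    have hr := h.r_pos hq'
    have hε := h.eps_pos
    have h3 : -(2 * N) ≤ α * coeffY U p q / (1 - q.2.1 + ε) := by
      rw [le_div_iff₀ hr]
      have h5 : |α * coeffY U p q| ≤ |coeffY U p q| := by
        rw [abs_mul, abs_of_pos hα]
        exact mul_le_of_le_one_left (abs_nonneg _) hα1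
      have h4 := (abs_le.1 (h5.trans h2)).1
      nlinarith
    linarith
  · intro y hy t ht
    have hm : ((0 : ℝ), y, t) ∈ closedBox L T :=
      ⟨⟨le_rfl, hL⟩, Ioo_subset_Icc_self hy, Ioo_subset_Icc_self ht⟩
    have := hx0 y hy t ht
    rw [abs_mul, abs_of_nonneg (h.coeffX_bounds hm).1, mul_div_assoc] at this
    exact this
  · intro x hx t ht
    exact ⟨hy1 x hx t ht, by simp [coeffY]⟩
  · intro x hx t ht
    have h1 := h.bound_U x (Ioo_subset_Icc_self hx) t (Ioo_subset_Icc_self ht)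
    have e : coeffY U p (x, 0, t) = p x t := by simp [coeffY]
    have h2 : N ≤ N ^ 4 := le_self_pow₀ hN (by norm_num)
    have h3 := hy0 x hx t ht
    simp only [e]
    exact ⟨h1.2.2.2.1, by linarith⟩

end FlowBounds

namespace FlowBounds

variable {L T N ε α : ℝ} {U p : ℝ → ℝ → ℝ} {u : ℝ → ℝ → ℝ → ℝ}

lemma r_le_two (h : FlowBounds L T N ε U p u) {q : ℝ × ℝ × ℝ} (hq : q ∈ closedBox L T) :
    1 - q.2.1 + ε ≤ 2 := by
  have := hq.2.1.1; have := h.eps_le; linarith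

lemma abs_coeffZero_mul_le (h : FlowBounds L T N ε U p u) {q : ℝ × ℝ × ℝ}
    (hq : q ∈ closedBox L T) :
    |coeffZero U p q * u q.1 q.2.1 q.2.2| ≤ 2 * N ^ 2 * (1 - q.2.1 + ε) := by
  have hb := h.bound_u q.1 hq.1 q.2.1 hq.2.1 q.2.2 hq.2.2
  have hN := h.one_le
  have hε := h.eps_pos
  rw [abs_mul, abs_of_nonneg hb.1]
  calc |coeffZero U p q| * u q.1 q.2.1 q.2.2 ≤ 2 * N * (N * (1 - q.2.1 + ε)) := by
        gcongr
        · exact hb.1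
        · exact h.coeffZero_bound hq
        · linarith
    _ = _ := by ring

lemma abs_coeffY_mul_le (h : FlowBounds L T N ε U p u) {q : ℝ × ℝ × ℝ}
    (hq : q ∈ closedBox L T) {w : ℝ} (hw : |w| ≤ N) :
    |coeffY U p q * w| ≤ 2 * N ^ 2 * (1 - q.2.1 + ε) := by
  have hN := h.one_le
  have hε := h.eps_pos
  have h1 := hq.2.1.2
  rw [abs_mul]
  calc |coeffY U p q| * |w| ≤ 2 * N * (1 - q.2.1 + ε) * N := by
        gcongr
        exact (h.coeffY_bound hq).trans (by gcongr; linarith)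
    _ = _ := by ring

lemma abs_coeffX_mul_le (h : FlowBounds L T N ε U p u) {q : ℝ × ℝ × ℝ}
    (hq : q ∈ closedBox L T) {w : ℝ} (hw : |w| ≤ N * (1 - q.2.1)) :
    |coeffX ε U q * w| ≤ 2 * N ^ 2 * (1 - q.2.1 + ε) := by
  have hN := h.one_le
  have hε := h.eps_pos
  have ha := h.coeffX_bounds hq
  rw [abs_mul, abs_of_nonneg ha.1]
  calc coeffX ε U q * |w| ≤ 2 * N * (N * (1 - q.2.1 + ε)) := by
        gcongr
        · exact ha.2
        · exact hw.trans (by gcongr; linarith)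
    _ = _ := by ring

lemma div_sq_le (h : FlowBounds L T N ε U p u) {q : ℝ × ℝ × ℝ} (hq : q ∈ closedBox L T)
    {v w : ℝ} (hw : |w| ≤ N)
    (hv : |v - (u q.1 q.2.1 q.2.2 + ε) ^ 2 * w| ≤ 6 * N ^ 2 * (1 - q.2.1 + ε)) :
    |v| / (u q.1 q.2.1 q.2.2 + ε) ^ 2 ≤ 8 * N ^ 4 / (1 - q.2.1 + ε) :=
  boundary_div_sq_le h.one_le (h.r_pos hq) (h.r_le_two hq)
    (h.bound_u q.1 hq.1 q.2.1 hq.2.1 q.2.2 hq.2.2).2.1 hw hv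

/-- The part of the source terms controlled by `∂_yu`. -/
def sourceY (N ε : ℝ) (u : ℝ → ℝ → ℝ → ℝ) (q : ℝ × ℝ × ℝ) : ℝ :=
  2 * N ^ 3 * (|Dy u q.1 q.2.1 q.2.2| + 1) / (1 - q.2.1 + ε)

lemma continuousOn_sourceY (h : FlowBounds L T N ε U p u) :
    ContinuousOn (sourceY N ε u) (closedBox L T) :=
  h.continuousOn_div_r
    (continuous_const.mul (h.smooth_u.dy.continuous.abs.add continuous_const)).continuousOn

lemma sourceY_nonneg (h : FlowBounds L T N ε U p u) {q : ℝ × ℝ × ℝ} (hq : q ∈ closedBox L T) :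
    0 ≤ sourceY N ε u q := by
  have := h.r_pos hq
  have := h.one_le
  unfold sourceY
  positivity

lemma abs_mul_mul_add_le (h : FlowBounds L T N ε U p u) {q : ℝ × ℝ × ℝ} (hq : q ∈ closedBox L T)
    {k l : ℝ} (hk : |k| ≤ N) (hl : |l| ≤ N) :
    |(1 - q.2.1) * (q.2.1 * k + l)| ≤ 2 * N * (1 - q.2.1 + ε) := by
  have hN := h.one_le
  have hε := h.eps_pos
  have h1 := hq.2.1.2
  rw [abs_mul, abs_of_nonneg (by linarith)]
  calc (1 - q.2.1) * |q.2.1 * k + l| ≤ (1 - q.2.1 + ε) * (2 * N) := by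
        gcongr
        · linarith
        · exact abs_mul_add_le hq.2.1 hk hl
    _ = _ := by ring

theorem integral_Dx_le (h : FlowBounds L T N ε U p u) (hL : 0 ≤ L) (hT : 0 ≤ T)
    (hα : 0 < α) (hα1 : α ≤ 1) :
    ∫ q in QT L T, (1 - q.2.1 + ε) ^ α * (|Dx u q.1 q.2.1 q.2.2| / (u q.1 q.2.1 q.2.2 + ε) ^ 2) ≤
      exp ((6 * N + 3 * N + 1) * T) * ((∫ q in QT L T, (1 - q.2.1 + ε) ^ α * sourceY N ε u q) +
        8 * N ^ 4 * (T * (2 / α) + L * (2 / α) + 3 * L * T)) := by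
  have hN := h.one_le
  have hε := h.eps_pos
  refine h.integral_mul_deriv_div_sq_le hL hT hα hα1 h.smooth_u.dx h.continuousOn_sourceY
    (fun q hq => h.sourceY_nonneg hq) ?_ ?_ ?_ (fun x hx t ht => (h.top_eq_zero hx ht).1)
    (fun x hx t ht => (h.bottom x hx t ht).2.1)
  · intro q hq
    have hq' := QT_subset_closedBox L T hq
    have hb := h.bound_u q.1 hq'.1 q.2.1 hq'.2.1 q.2.2 hq'.2.2
    have hdU := h.bound_dU q.1 hq'.1 q.2.2 hq'.2.2
    have h0 := h.eq q.1 hq'.1 q.2.1 hq'.2.1 q.2.2 hq'.2.2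
    have h1 := h.eq_x hq.1 hq.2.1 hq.2.2
    have := linearized_residual_bound (N := N) (r := 1 - q.2.1 + ε)
      (s := u q.1 q.2.1 q.2.2 + ε) (u := u q.1 q.2.1 q.2.2)
      (u' := Dt u q.1 q.2.1 q.2.2 + coeffX ε U q * Dx u q.1 q.2.1 q.2.2
        + coeffY U p q * Dy u q.1 q.2.1 q.2.2)
      (uyy := Dy (Dy u) q.1 q.2.1 q.2.2) hN (h.r_pos hq') hb.2.1 hb.1
      (by linarith) (h.coeffZero_bound hq')
      (h.abs_mul_mul_add_le hq' hdU.1 hdU.2.2.2.1)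
      (abs_mul_add_le (one_sub_mem hq'.2.1) hdU.1 hdU.2.2.2.1)
      (by linear_combination h0) h1
    refine this.trans ?_
    have hw : |q.2.1 * pd1 U q.1 q.2.2 * Dx u q.1 q.2.1 q.2.2| / (u q.1 q.2.1 q.2.2 + ε) ^ 2
        ≤ N * (|Dx u q.1 q.2.1 q.2.2| / (u q.1 q.2.1 q.2.2 + ε) ^ 2) := by
      rw [abs_mul, mul_div_assoc]
      gcongr
      exact (abs_mul_le_of_mem hq'.2.1).trans (h.bound_U q.1 hq'.1 q.2.2 hq'.2.2).2.2.1
    unfold sourceY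
    linarith
  · intro y hy t ht
    have hm : ((0 : ℝ), y, t) ∈ closedBox L T :=
      ⟨⟨le_rfl, hL⟩, Ioo_subset_Icc_self hy, Ioo_subset_Icc_self ht⟩
    have hd := h.inflow y hy t ht
    refine h.div_sq_le hm hd.2.2 ?_
    have e := h.eq 0 hm.1 y hm.2.1 t hm.2.2
    have h1 := h.abs_coeffZero_mul_le hm
    have h2 := h.abs_coeffY_mul_le hm hd.2.1
    have h3 : |Dt u 0 y t| ≤ 2 * N ^ 2 * (1 - y + ε) := by
      refine hd.1.trans ?_
      have := hy.2
      have : N ≤ N ^ 2 := le_self_pow₀ hN (by norm_num)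
      have : 0 ≤ 1 - y := by linarith
      nlinarith
    have e' : coeffX ε U (0, y, t) * Dx u 0 y t - (u 0 y t + ε) ^ 2 * Dy (Dy u) 0 y t
        = -(Dt u 0 y t + coeffY U p (0, y, t) * Dy u 0 y t
          + coeffZero U p (0, y, t) * u 0 y t) := by linear_combination e
    simp only at h1 h2 ⊢
    rw [e', abs_neg]
    refine (abs_add_three _ _ _).trans ?_
    linarith
  · intro x hx y hy
    have hm : (x, y, (0 : ℝ)) ∈ closedBox L T :=
      ⟨Ioo_subset_Icc_self hx, Ioo_subset_Icc_self hy, ⟨le_rfl, hT⟩⟩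
    refine h.div_sq_le (w := 0) hm (by simpa using by linarith) ?_
    have := hy.2
    have : N ≤ N ^ 2 := le_self_pow₀ hN (by norm_num)
    have : 0 ≤ 1 - y := by linarith
    simp only [mul_zero, sub_zero]
    refine (h.initial x hx y hy).1.trans ?_
    nlinarith

theorem integral_Dt_le (h : FlowBounds L T N ε U p u) (hL : 0 ≤ L) (hT : 0 ≤ T)
    (hα : 0 < α) (hα1 : α ≤ 1) :
    ∫ q in QT L T, (1 - q.2.1 + ε) ^ α * (|Dt u q.1 q.2.1 q.2.2| / (u q.1 q.2.1 q.2.2 + ε) ^ 2) ≤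
      exp ((6 * N + 3 * N + 1) * T) * ((∫ q in QT L T, (1 - q.2.1 + ε) ^ α * (sourceY N ε u q +
        N * (|Dx u q.1 q.2.1 q.2.2| / (u q.1 q.2.1 q.2.2 + ε) ^ 2))) +
        8 * N ^ 4 * (T * (2 / α) + L * (2 / α) + 3 * L * T)) := by
  have hN := h.one_le
  have hε := h.eps_pos
  refine h.integral_mul_deriv_div_sq_le hL hT hα hα1 h.smooth_u.dt
    (h.continuousOn_sourceY.add (continuousOn_const.mul (h.continuousOn_div_sq h.smooth_u.dx)))
    (fun q hq => add_nonneg (h.sourceY_nonneg hq) (by positivity)) ?_ ?_ ?_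
    (fun x hx t ht => (h.top_eq_zero hx ht).2) (fun x hx t ht => (h.bottom x hx t ht).2.2)
  · intro q hq
    have hq' := QT_subset_closedBox L T hq
    have hb := h.bound_u q.1 hq'.1 q.2.1 hq'.2.1 q.2.2 hq'.2.2
    have hdU := h.bound_dU q.1 hq'.1 q.2.2 hq'.2.2
    have h0 := h.eq q.1 hq'.1 q.2.1 hq'.2.1 q.2.2 hq'.2.2
    have h1 := h.eq_t hq.1 hq.2.1 hq.2.2
    have := linearized_residual_bound (N := N) (r := 1 - q.2.1 + ε)
      (s := u q.1 q.2.1 q.2.2 + ε) (u := u q.1 q.2.1 q.2.2)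
      (u' := Dt u q.1 q.2.1 q.2.2 + coeffX ε U q * Dx u q.1 q.2.1 q.2.2
        + coeffY U p q * Dy u q.1 q.2.1 q.2.2)
      (uyy := Dy (Dy u) q.1 q.2.1 q.2.2) hN (h.r_pos hq') hb.2.1 hb.1
      (by linarith) (h.coeffZero_bound hq')
      (h.abs_mul_mul_add_le hq' hdU.2.1 hdU.2.2.2.2)
      (abs_mul_add_le (one_sub_mem hq'.2.1) hdU.2.1 hdU.2.2.2.2)
      (by linear_combination h0) h1
    refine this.trans ?_
    have hw : |q.2.1 * pd2 U q.1 q.2.2 * Dx u q.1 q.2.1 q.2.2| / (u q.1 q.2.1 q.2.2 + ε) ^ 2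
        ≤ N * (|Dx u q.1 q.2.1 q.2.2| / (u q.1 q.2.1 q.2.2 + ε) ^ 2) := by
      rw [abs_mul, mul_div_assoc]
      gcongr
      exact (abs_mul_le_of_mem hq'.2.1).trans hdU.2.2.1
    have hz : 0 ≤ N * (|Dt u q.1 q.2.1 q.2.2| / (u q.1 q.2.1 q.2.2 + ε) ^ 2) := by positivity
    unfold sourceY
    linarith
  · intro y hy t ht
    have hm : ((0 : ℝ), y, t) ∈ closedBox L T :=
      ⟨⟨le_rfl, hL⟩, Ioo_subset_Icc_self hy, Ioo_subset_Icc_self ht⟩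
    refine h.div_sq_le (w := 0) hm (by simpa using by linarith) ?_
    have h1 := h.abs_coeffX_mul_le hm (h.inflow y hy t ht).1
    have hr := h.r_pos hm
    simp only [mul_zero, sub_zero] at h1 hr ⊢
    refine h1.trans ?_
    gcongr
    norm_num
  · intro x hx y hy
    have hm : (x, y, (0 : ℝ)) ∈ closedBox L T :=
      ⟨Ioo_subset_Icc_self hx, Ioo_subset_Icc_self hy, ⟨le_rfl, hT⟩⟩
    have hd := h.initial x hx y hy
    refine h.div_sq_le hm hd.2.2 ?_
    have e := h.eq x hm.1 y hm.2.1 0 hm.2.2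
    have h1 := h.abs_coeffZero_mul_le hm
    have h2 := h.abs_coeffY_mul_le hm hd.2.1
    have h3 := h.abs_coeffX_mul_le hm hd.1
    have e' : Dt u x y 0 - (u x y 0 + ε) ^ 2 * Dy (Dy u) x y 0
        = -(coeffX ε U (x, y, 0) * Dx u x y 0 + coeffY U p (x, y, 0) * Dy u x y 0
          + coeffZero U p (x, y, 0) * u x y 0) := by linear_combination e
    simp only at h1 h2 h3 ⊢
    rw [e', abs_neg]
    refine (abs_add_three _ _ _).trans ?_
    linarith

theorem integral_sourceY_le (h : FlowBounds L T N ε U p u) (hL : 0 ≤ L) (hT : 0 ≤ T)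
    (hα : 0 < α) (hα1 : α ≤ 1) :
    ∫ q in QT L T, (1 - q.2.1 + ε) ^ α * sourceY N ε u q ≤
      2 * N ^ 3 * ((∫ q in QT L T, (1 - q.2.1 + ε) ^ (α - 1) * Dy u q.1 q.2.1 q.2.2 ^ 2)
        + 2 * (L * T * (2 / α))) := by
  have hN := h.one_le
  have hw := integral_box_weight_le hL hT hα hα1 h.eps_pos h.eps_le
  have cw := h.continuousOn_weight (α - 1)
  have cE := cw.mul (h.smooth_u.dy.continuous.pow 2).continuousOn
  have iw := integrableOn_QT cw
  have iE : IntegrableOn (fun q : ℝ × ℝ × ℝ => (1 - q.2.1 + ε) ^ (α - 1) *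
    Dy u q.1 q.2.1 q.2.2 ^ 2) (QT L T) := integrableOn_QT cE
  calc ∫ q in QT L T, (1 - q.2.1 + ε) ^ α * sourceY N ε u q
      ≤ ∫ q in QT L T, 2 * N ^ 3 * ((1 - q.2.1 + ε) ^ (α - 1) * Dy u q.1 q.2.1 q.2.2 ^ 2
          + 2 * (1 - q.2.1 + ε) ^ (α - 1)) := by
        refine setIntegral_mono_on
          (integrableOn_QT ((h.continuousOn_weight α).mul h.continuousOn_sourceY))
          ((iE.add (iw.const_mul 2)).const_mul _) (measurableSet_QT L T) fun q hq => ?_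
        have hr := h.r_pos (QT_subset_closedBox L T hq)
        have hd : |Dy u q.1 q.2.1 q.2.2| + 1 ≤ Dy u q.1 q.2.1 q.2.2 ^ 2 + 2 := by
          nlinarith [sq_nonneg (|Dy u q.1 q.2.1 q.2.2| - 1), sq_abs (Dy u q.1 q.2.1 q.2.2)]
        have e : (1 - q.2.1 + ε) ^ α * sourceY N ε u q =
            2 * N ^ 3 * ((1 - q.2.1 + ε) ^ (α - 1) * (|Dy u q.1 q.2.1 q.2.2| + 1)) := by
          unfold sourceY
          rw [rpow_sub_one hr.ne']
          ring
        rw [e]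
        calc 2 * N ^ 3 * ((1 - q.2.1 + ε) ^ (α - 1) * (|Dy u q.1 q.2.1 q.2.2| + 1))
            ≤ 2 * N ^ 3 * ((1 - q.2.1 + ε) ^ (α - 1) * (Dy u q.1 q.2.1 q.2.2 ^ 2 + 2)) := by
              gcongr
          _ = _ := by ring
    _ = 2 * N ^ 3 * ((∫ q in QT L T, (1 - q.2.1 + ε) ^ (α - 1) * Dy u q.1 q.2.1 q.2.2 ^ 2)
        + 2 * ∫ q in QT L T, (1 - q.2.1 + ε) ^ (α - 1)) := by
        rw [integral_const_mul, integral_add iE (iw.const_mul 2), integral_const_mul]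
    _ ≤ _ := by gcongr

theorem abs_Dyy_le (h : FlowBounds L T N ε U p u) {q : ℝ × ℝ × ℝ} (hq : q ∈ closedBox L T) :
    |Dy (Dy u) q.1 q.2.1 q.2.2| ≤ |Dt u q.1 q.2.1 q.2.2| / (u q.1 q.2.1 q.2.2 + ε) ^ 2
      + 2 * N * (|Dx u q.1 q.2.1 q.2.2| / (u q.1 q.2.1 q.2.2 + ε) ^ 2) + sourceY N ε u q := by
  have hN := h.one_le
  have hr := h.r_pos hq
  have hs := h.s_pos hq
  have hε := h.eps_pos
  have hb := h.bound_u q.1 hq.1 q.2.1 hq.2.1 q.2.2 hq.2.2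
  have e := h.eq q.1 hq.1 q.2.1 hq.2.1 q.2.2 hq.2.2
  have ha := h.coeffX_bounds hq
  have hy := h.coeffY_bound hq
  have hc := h.coeffZero_bound hq
  set s := u q.1 q.2.1 q.2.2 + ε with hs_def
  set r := 1 - q.2.1 + ε with hr_def
  have hrs : r ≤ N * s := by
    have := hb.2.1
    rwa [div_le_iff₀' (by linarith)] at this
  have hs2 : r ^ 2 ≤ N ^ 2 * s ^ 2 := by rw [← mul_pow]; gcongr
  have hs2' : 0 < s ^ 2 := pow_pos hs 2
  have e' : Dy (Dy u) q.1 q.2.1 q.2.2 = Dt u q.1 q.2.1 q.2.2 / s ^ 2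
      + coeffX ε U q * (Dx u q.1 q.2.1 q.2.2 / s ^ 2)
      + (coeffY U p q * Dy u q.1 q.2.1 q.2.2 / s ^ 2
        + coeffZero U p q * u q.1 q.2.1 q.2.2 / s ^ 2) := by
    field_simp
    linear_combination -e
  have h1 : |coeffX ε U q * (Dx u q.1 q.2.1 q.2.2 / s ^ 2)|
      ≤ 2 * N * (|Dx u q.1 q.2.1 q.2.2| / s ^ 2) := by
    rw [abs_mul, abs_div, abs_of_pos hs2', abs_of_nonneg ha.1]
    gcongr
    exact ha.2
  have h2 : |coeffY U p q * Dy u q.1 q.2.1 q.2.2 / s ^ 2|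
      ≤ 2 * N ^ 3 * |Dy u q.1 q.2.1 q.2.2| / r := by
    rw [abs_div, abs_of_pos hs2', abs_mul, div_le_div_iff₀ hs2' hr]
    calc |coeffY U p q| * |Dy u q.1 q.2.1 q.2.2| * r
        ≤ 2 * N * r * |Dy u q.1 q.2.1 q.2.2| * r := by
          gcongr
          refine hy.trans ?_
          gcongr
          linarith
      _ = 2 * N * |Dy u q.1 q.2.1 q.2.2| * r ^ 2 := by ring
      _ ≤ 2 * N * |Dy u q.1 q.2.1 q.2.2| * (N ^ 2 * s ^ 2) := by gcongr
      _ = _ := by ring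
  have h3 : |coeffZero U p q * u q.1 q.2.1 q.2.2 / s ^ 2| ≤ 2 * N ^ 3 / r := by
    rw [abs_div, abs_of_pos hs2', abs_mul, abs_of_nonneg hb.1, div_le_div_iff₀ hs2' hr]
    have hus : u q.1 q.2.1 q.2.2 ≤ s := by linarith
    have hu0 := hb.1
    calc |coeffZero U p q| * u q.1 q.2.1 q.2.2 * r ≤ 2 * N * s * (N * s) := by gcongr
      _ = 2 * N ^ 2 * s ^ 2 := by ring
      _ ≤ 2 * N ^ 3 * s ^ 2 := by
          have : N ^ 2 ≤ N ^ 3 := pow_le_pow_right₀ hN (by norm_num)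
          gcongr
  have e3 : sourceY N ε u q = 2 * N ^ 3 * |Dy u q.1 q.2.1 q.2.2| / r + 2 * N ^ 3 / r := by
    unfold sourceY
    rw [← hr_def]
    ring
  have e4 : |Dt u q.1 q.2.1 q.2.2 / s ^ 2| = |Dt u q.1 q.2.1 q.2.2| / s ^ 2 := by
    rw [abs_div, abs_of_pos hs2']
  rw [e3, e', ← e4]
  refine (abs_add_three _ _ _).trans ?_
  have := abs_add_le (coeffY U p q * Dy u q.1 q.2.1 q.2.2 / s ^ 2)
    (coeffZero U p q * u q.1 q.2.1 q.2.2 / s ^ 2)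
  linarith

end FlowBounds

theorem exists_weighted_Dyy_bound {L T α : ℝ} (N : ℝ) (hL : 0 ≤ L) (hT : 0 ≤ T) (hα : 0 < α)
    (hα1 : α < 1) : ∃ C : ℝ, ∀ (ε : ℝ) (U p : ℝ → ℝ → ℝ) (u : ℝ → ℝ → ℝ → ℝ),
      FlowBounds L T N ε U p u →
      ∫ q in QT L T, (1 - q.2.1 + ε) ^ α * |Dy (Dy u) q.1 q.2.1 q.2.2| ≤ C := by
  let E := N / α * (T * (2 * N * N / (1 - α) * (2 / α)) + L * (N / (1 - α) * (2 / α))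
        + L * (T * (2 * N * (2 * N)))
        + (2 * N / (1 - α) + 2 * N) * N * (L * T * (2 / α)))
  let J := 2 * N ^ 3 * (E + 2 * (L * T * (2 / α)))
  let e := exp ((6 * N + 3 * N + 1) * T)
  let B := 8 * N ^ 4 * (T * (2 / α) + L * (2 / α) + 3 * L * T)
  refine ⟨e * (J + N * (e * (J + B)) + B) + 2 * N * (e * (J + B)) + J, fun ε U p u h => ?_⟩
  have hN := h.one_le
  have cw := h.continuousOn_weight α
  have iS : IntegrableOn (fun q : ℝ × ℝ × ℝ => (1 - q.2.1 + ε) ^ α *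
      FlowBounds.sourceY N ε u q) (QT L T) :=
    integrableOn_QT (cw.mul h.continuousOn_sourceY)
  have iX : IntegrableOn (fun q : ℝ × ℝ × ℝ => (1 - q.2.1 + ε) ^ α *
      (|Dx u q.1 q.2.1 q.2.2| / (u q.1 q.2.1 q.2.2 + ε) ^ 2)) (QT L T) :=
    integrableOn_QT (cw.mul (h.continuousOn_div_sq h.smooth_u.dx))
  have iT : IntegrableOn (fun q : ℝ × ℝ × ℝ => (1 - q.2.1 + ε) ^ α *
      (|Dt u q.1 q.2.1 q.2.2| / (u q.1 q.2.1 q.2.2 + ε) ^ 2)) (QT L T) :=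
    integrableOn_QT (cw.mul (h.continuousOn_div_sq h.smooth_u.dt))
  have hJ : ∫ q in QT L T, (1 - q.2.1 + ε) ^ α * FlowBounds.sourceY N ε u q ≤ J := by
    refine (h.integral_sourceY_le hL hT hα hα1.le).trans ?_
    exact mul_le_mul_of_nonneg_left
      (add_le_add (h.integral_mul_sq_deriv_y_le hL hT hα hα1) le_rfl) (by positivity)
  have hX := h.integral_Dx_le hL hT hα hα1.le
  have hX' : ∫ q in QT L T, (1 - q.2.1 + ε) ^ α *
      (|Dx u q.1 q.2.1 q.2.2| / (u q.1 q.2.1 q.2.2 + ε) ^ 2) ≤ e * (J + B) := by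
    exact hX.trans (mul_le_mul_of_nonneg_left (add_le_add hJ le_rfl) (exp_pos _).le)
  have hTt := h.integral_Dt_le hL hT hα hα1.le
  have hT' : ∫ q in QT L T, (1 - q.2.1 + ε) ^ α *
      (|Dt u q.1 q.2.1 q.2.2| / (u q.1 q.2.1 q.2.2 + ε) ^ 2)
        ≤ e * (J + N * (e * (J + B)) + B) := by
    refine hTt.trans ?_
    have : ∫ q in QT L T, (1 - q.2.1 + ε) ^ α * (FlowBounds.sourceY N ε u q +
        N * (|Dx u q.1 q.2.1 q.2.2| / (u q.1 q.2.1 q.2.2 + ε) ^ 2)) =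
        (∫ q in QT L T, (1 - q.2.1 + ε) ^ α * FlowBounds.sourceY N ε u q) +
        N * ∫ q in QT L T, (1 - q.2.1 + ε) ^ α *
          (|Dx u q.1 q.2.1 q.2.2| / (u q.1 q.2.1 q.2.2 + ε) ^ 2) := by
      rw [← integral_const_mul, ← integral_add iS (iX.const_mul N)]
      congr 1
      ext q
      ring
    rw [this]
    exact mul_le_mul_of_nonneg_left (add_le_add (add_le_add hJ
      (mul_le_mul_of_nonneg_left hX' (by linarith))) le_rfl) (exp_pos _).le
  calc ∫ q in QT L T, (1 - q.2.1 + ε) ^ α * |Dy (Dy u) q.1 q.2.1 q.2.2|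
      ≤ ∫ q in QT L T, ((1 - q.2.1 + ε) ^ α *
          (|Dt u q.1 q.2.1 q.2.2| / (u q.1 q.2.1 q.2.2 + ε) ^ 2) + 2 * N *
          ((1 - q.2.1 + ε) ^ α * (|Dx u q.1 q.2.1 q.2.2| / (u q.1 q.2.1 q.2.2 + ε) ^ 2))
          + (1 - q.2.1 + ε) ^ α * FlowBounds.sourceY N ε u q) := by
        refine setIntegral_mono_on
          (integrableOn_QT (cw.mul h.smooth_u.dy.dy.continuous.abs.continuousOn))
          ((iT.add (iX.const_mul (2 * N))).add iS) (measurableSet_QT L T) fun q hq => ?_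
        have hr := h.r_pos (QT_subset_closedBox L T hq)
        have := mul_le_mul_of_nonneg_left (h.abs_Dyy_le (QT_subset_closedBox L T hq))
          (rpow_nonneg hr.le α)
        linarith
    _ = (∫ q in QT L T, (1 - q.2.1 + ε) ^ α *
          (|Dt u q.1 q.2.1 q.2.2| / (u q.1 q.2.1 q.2.2 + ε) ^ 2)) + 2 * N *
          (∫ q in QT L T, (1 - q.2.1 + ε) ^ α *
            (|Dx u q.1 q.2.1 q.2.2| / (u q.1 q.2.1 q.2.2 + ε) ^ 2))
          + ∫ q in QT L T, (1 - q.2.1 + ε) ^ α * FlowBounds.sourceY N ε u q := by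
        rw [← integral_const_mul, ← integral_add iT (iX.const_mul (2 * N))]
        exact integral_add (iT.add (iX.const_mul (2 * N))) iS
    _ ≤ _ := by gcongr

lemma closure_QT {L T : ℝ} (hL : 0 < L) (hT : 0 < T) : closure (QT L T) = closedBox L T := by
  unfold QT closedBox
  rw [closure_prod_eq, closure_prod_eq, closure_Ioo hL.ne, closure_Ioo one_ne_zero.symm,
    closure_Ioo hT.ne]

lemma abs_le_mul_one_sub {f f' : ℝ → ℝ} {M : ℝ} (hf : ∀ y ∈ Icc (0:ℝ) 1, HasDerivAt f (f' y) y)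
    (hM : ∀ y ∈ Icc (0:ℝ) 1, |f' y| ≤ M) (h1 : f 1 = 0) {y : ℝ} (hy : y ∈ Icc (0:ℝ) 1) :
    |f y| ≤ M * (1 - y) := by
  have := (convex_Icc (0:ℝ) 1).norm_image_sub_le_of_norm_hasDerivWithin_le
    (fun x hx => (hf x hx).hasDerivWithinAt) hM (right_mem_Icc.2 zero_le_one) hy
  rw [h1, sub_zero, norm_eq_abs, norm_eq_abs, abs_of_nonpos (sub_nonpos.2 hy.2), neg_sub] at this
  exact this

/-- The normalized pressure gradient `p = -∂ₓP/U`. -/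
def pressureRatio (U P : ℝ → ℝ → ℝ) (x t : ℝ) : ℝ := -pd1 P x t / U x t

lemma abs_deriv_quotient_le {M g g' w w' : ℝ} (hM : 0 < M) (hw : M⁻¹ ≤ w) (hg : |g| ≤ M)
    (hg' : |g'| ≤ M) (hw' : |w'| ≤ M) : |(-g' * w - -g * w') / w ^ 2| ≤ M ^ 2 + M ^ 4 := by
  have hw0 : 0 < w := (inv_pos.2 hM).trans_le hw
  have hi : w⁻¹ ≤ M := inv_le_of_inv_le₀ hM hw
  have e : (-g' * w - -g * w') / w ^ 2 = -(g' * w⁻¹) + g * w' * w⁻¹ ^ 2 := by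
    field_simp
    ring
  have hi0 : 0 ≤ w⁻¹ := (inv_pos.2 hw0).le
  have h1 : |g' * w⁻¹| ≤ M ^ 2 := by
    rw [abs_mul, abs_of_nonneg hi0, sq]
    gcongr
  have h2 : |g * w' * w⁻¹ ^ 2| ≤ M ^ 4 := by
    rw [abs_mul, abs_mul, abs_of_nonneg (pow_nonneg hi0 2)]
    calc |g| * |w'| * w⁻¹ ^ 2 ≤ M * M * M ^ 2 := by gcongr
      _ = M ^ 4 := by ring
  rw [e]
  refine (abs_add_le _ _).trans ?_
  rw [abs_neg]
  linarith

namespace EulerData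

variable {L T M : ℝ} {U P : ℝ → ℝ → ℝ}

lemma hasDerivAt_pressureRatio (h : EulerData L T M U P) {x t : ℝ} (hx : x ∈ Icc 0 L)
    (ht : t ∈ Icc 0 T) :
    HasDerivAt (fun s => pressureRatio U P s t)
      ((-pd1 (pd1 P) x t * U x t - -pd1 P x t * pd1 U x t) / U x t ^ 2) x ∧
    HasDerivAt (fun s => pressureRatio U P x s)
      ((-pd2 (pd1 P) x t * U x t - -pd1 P x t * pd2 U x t) / U x t ^ 2) t := by
  obtain ⟨hU, hP, hpos, -⟩ := h
  exact ⟨(hP.smooth2_pd1.hasDerivAt_fst x t).neg.div (hU.hasDerivAt_fst x t) (hpos x hx t ht).ne',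
    (hP.smooth2_pd1.hasDerivAt_snd x t).neg.div (hU.hasDerivAt_snd x t) (hpos x hx t ht).ne'⟩

lemma pressureRatio_bounds (h : EulerData L T M U P) (hM : 0 < M) {x t : ℝ} (hx : x ∈ Icc 0 L)
    (ht : t ∈ Icc 0 T) : 0 ≤ pressureRatio U P x t ∧ pressureRatio U P x t ≤ M ^ 2 ∧
      |pd1 (pressureRatio U P) x t| ≤ M ^ 2 + M ^ 4 ∧
      |pd2 (pressureRatio U P) x t| ≤ M ^ 2 + M ^ 4 := by
  have hd := h.hasDerivAt_pressureRatio hx ht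
  obtain ⟨hU, hP, hpos, -, hfav, bU, bP, hinv⟩ := h
  have hU0 := hpos x hx t ht
  have hi : (U x t)⁻¹ ≤ M := inv_le_of_inv_le₀ hM (hinv x hx t ht)
  have hi0 : 0 ≤ (U x t)⁻¹ := (inv_pos.2 hU0).le
  obtain ⟨-, hU1, hU2, -⟩ := bU x hx t ht
  obtain ⟨-, hP1, -, hP11, -, hP21⟩ := bP x hx t ht
  have hf := hfav x hx t ht
  refine ⟨div_nonneg (by linarith) hU0.le, ?_, ?_, ?_⟩
  · unfold pressureRatio
    rw [div_eq_mul_inv, sq]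
    have := (abs_le.1 hP1).1
    gcongr
    linarith
  · rw [pd1, hd.1.deriv]
    exact abs_deriv_quotient_le hM (hinv x hx t ht) hP1 hP11 hU1
  · rw [pd2, hd.2.deriv]
    exact abs_deriv_quotient_le hM (hinv x hx t ht) hP1 hP21 hU2

lemma continuousOn_pressureRatio (h : EulerData L T M U P) :
    ContinuousOn (fun q : ℝ × ℝ => pressureRatio U P q.1 q.2) (Icc 0 L ×ˢ Icc 0 T) := by
  obtain ⟨hU, hP, hpos, -⟩ := h
  exact hP.smooth2_pd1.continuous.neg.continuousOn.div hU.continuous.continuousOn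
    fun q hq => (hpos q.1 hq.1 q.2 hq.2).ne'

lemma coeffY_eq (h : EulerData L T M U P) {x y t : ℝ} (hx : x ∈ Icc 0 L) (ht : t ∈ Icc 0 T) :
    bcoef U x y t = coeffY U (pressureRatio U P) (x, y, t) := by
  obtain ⟨-, -, hpos, hB, -⟩ := h
  have h0 := (hpos x hx t ht).ne'
  have hB' : pd2 U x t = -pd1 P x t - U x t * pd1 U x t := by linarith [hB x hx t ht]
  simp only [bcoef, coeffY, pressureRatio, hB']
  field_simp
  ring

end EulerData

lemma ccoef_eq (U P : ℝ → ℝ → ℝ) (x y t : ℝ) :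
    ccoef U P x y t = coeffZero U (pressureRatio U P) (x, y, t) := by
  simp only [ccoef, coeffZero, pressureRatio]
  ring

lemma bottom_deriv_bound {M s uy v p z zy v' p' : ℝ} (hM : 1 ≤ M) (hs : M⁻¹ ≤ s)
    (hv' : |v'| ≤ M) (hp' : |p'| ≤ M ^ 2 + M ^ 4) (h0 : s * uy = v * s - p)
    (h1 : z * uy + s * zy = v' * s + v * z - p') :
    |zy - p * z / s ^ 2| ≤ 4 * M ^ 5 := by
  have hM0 : 0 < M := by linarith
  have hs0 : 0 < s := (inv_pos.2 hM0).trans_le hs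
  have hi : s⁻¹ ≤ M := inv_le_of_inv_le₀ hM0 hs
  have e : zy - p * z / s ^ 2 = v' - p' * s⁻¹ := by
    field_simp
    linear_combination s * h1 - z * h0
  have h2 : |p' * s⁻¹| ≤ (M ^ 2 + M ^ 4) * M := by
    rw [abs_mul, abs_of_nonneg (inv_pos.2 hs0).le]
    gcongr
  have k1 : M ^ 3 ≤ M ^ 5 := pow_le_pow_right₀ hM (by norm_num)
  have k2 : M ≤ M ^ 5 := le_self_pow₀ hM (by norm_num)
  have k3 : 0 < M ^ 5 := by positivity
  rw [e]
  refine (abs_sub _ _).trans ?_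
  nlinarith

namespace RegSolution

variable {L T ε M C₁ : ℝ} {U P u₀ u₁ v₀ : ℝ → ℝ → ℝ} {u : ℝ → ℝ → ℝ → ℝ}

lemma eq_on_closedBox (hu : RegSolution L T ε U P u₀ u₁ v₀ u) (hE : EulerData L T M U P)
    (hL : 0 < L) (hT : 0 < T) {q : ℝ × ℝ × ℝ} (hq : q ∈ closedBox L T) :
    Dt u q.1 q.2.1 q.2.2 - (u q.1 q.2.1 q.2.2 + ε) ^ 2 * Dy (Dy u) q.1 q.2.1 q.2.2
      + coeffX ε U q * Dx u q.1 q.2.1 q.2.2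
      + coeffY U (pressureRatio U P) q * Dy u q.1 q.2.1 q.2.2
      + coeffZero U (pressureRatio U P) q * u q.1 q.2.1 q.2.2 = 0 := by
  obtain ⟨hs, heq, -⟩ := hu
  have hcp : ContinuousOn (fun q : ℝ × ℝ × ℝ => pressureRatio U P q.1 q.2.2) (closedBox L T) :=
    hE.continuousOn_pressureRatio.comp (f := fun q : ℝ × ℝ × ℝ => (q.1, q.2.2)) (by fun_prop)
      fun _ hq => ⟨hq.1, hq.2.2⟩
  have hU := hE.1
  have hcU := hU.continuous.comp (by fun_prop : Continuous fun q : ℝ × ℝ × ℝ => (q.1, q.2.2))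
  have hck := hU.smooth2_pd1.continuous.comp
    (by fun_prop : Continuous fun q : ℝ × ℝ × ℝ => (q.1, q.2.2))
  have hcy : Continuous fun q : ℝ × ℝ × ℝ => q.2.1 := by fun_prop
  have hcX : Continuous (coeffX ε U) := (hcy.mul hcU).add continuous_const
  have hcY : ContinuousOn (coeffY U (pressureRatio U P)) (closedBox L T) :=
    (continuous_const.sub hcy).continuousOn.mul ((hcy.mul hck).continuousOn.add hcp)
  have hc0 : ContinuousOn (coeffZero U (pressureRatio U P)) (closedBox L T) :=
    ((continuous_const.sub hcy).mul hck).continuousOn.add hcp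
  have hc := ((((hs.dt.continuous.sub (((hs.continuous.add (continuous_const (y := ε))).pow 2).mul
    hs.dy.dy.continuous)).add (hcX.mul hs.dx.continuous)).continuousOn (s := closedBox L T)).add
    (hcY.mul hs.dy.continuous.continuousOn)).add (hc0.mul hs.continuous.continuousOn)
  refine Set.EqOn.of_subset_closure (s := QT L T) (g := fun _ => 0) ?_ hc continuousOn_const
    (QT_subset_closedBox L T) (closure_QT hL hT).ge hq
  rintro ⟨x, y, t⟩ ⟨hx, hy, ht⟩
  have := heq x hx y hy t ht
  rw [hE.coeffY_eq (Ioo_subset_Icc_self hx) (Ioo_subset_Icc_self ht), ccoef_eq, Dyy_eq] at this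
  exact this

lemma bounds_on_closedBox (hu : RegSolution L T ε U P u₀ u₁ v₀ u) (hL : 0 < L) (hT : 0 < T)
    (hb : ∀ x ∈ Ioo 0 L, ∀ y ∈ Ioo (0:ℝ) 1, ∀ t ∈ Ioo 0 T,
      C₁⁻¹ * (1 - y) ≤ u x y t ∧ u x y t ≤ C₁ * (1 - y)) {q : ℝ × ℝ × ℝ}
    (hq : q ∈ closedBox L T) : C₁⁻¹ * (1 - q.2.1) ≤ u q.1 q.2.1 q.2.2 ∧
      u q.1 q.2.1 q.2.2 ≤ C₁ * (1 - q.2.1) := by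
  have hc := Smooth3.continuous hu.1
  rw [← closure_QT hL hT] at hq
  refine closure_minimal (s := QT L T) (t := {q : ℝ × ℝ × ℝ | C₁⁻¹ * (1 - q.2.1) ≤
    u q.1 q.2.1 q.2.2 ∧ u q.1 q.2.1 q.2.2 ≤ C₁ * (1 - q.2.1)}) ?_ ?_ hq
  · rintro ⟨x, y, t⟩ ⟨hx, hy, ht⟩
    exact hb x hx y hy t ht
  · exact (isClosed_le (by fun_prop) hc).inter (isClosed_le hc (by fun_prop))

lemma initial_derivs (hu : RegSolution L T ε U P u₀ u₁ v₀ u) {x y : ℝ}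
    (hx : x ∈ Ioo 0 L) (hy : y ∈ Ioo (0:ℝ) 1) : Dx u x y 0 = pd1 u₀ x y ∧
      Dy u x y 0 = pd2 u₀ x y ∧ Dy (Dy u) x y 0 = pd2 (pd2 u₀) x y := by
  have h0 := hu.2.2.1
  have hy1 : ∀ y ∈ Ioo (0:ℝ) 1, Dy u x y 0 = pd2 u₀ x y := fun y hy => by
    refine Filter.EventuallyEq.deriv_eq ?_
    filter_upwards [isOpen_Ioo.mem_nhds hy] with s hs
    exact h0 x (Ioo_subset_Icc_self hx) s (Ioo_subset_Icc_self hs)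
  refine ⟨?_, hy1 y hy, ?_⟩
  · refine Filter.EventuallyEq.deriv_eq ?_
    filter_upwards [isOpen_Ioo.mem_nhds hx] with s hs
    exact h0 s (Ioo_subset_Icc_self hs) y (Ioo_subset_Icc_self hy)
  · refine Filter.EventuallyEq.deriv_eq ?_
    filter_upwards [isOpen_Ioo.mem_nhds hy] with s hs
    exact hy1 s hs

lemma inflow_derivs (hu : RegSolution L T ε U P u₀ u₁ v₀ u) {y t : ℝ}
    (hy : y ∈ Ioo (0:ℝ) 1) (ht : t ∈ Ioo 0 T) : Dt u 0 y t = pd2 u₁ y t ∧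
      Dy u 0 y t = pd1 u₁ y t ∧ Dy (Dy u) 0 y t = pd1 (pd1 u₁) y t := by
  have h1 := hu.2.2.2.1
  have hy1 : ∀ y ∈ Ioo (0:ℝ) 1, Dy u 0 y t = pd1 u₁ y t := fun y hy => by
    refine Filter.EventuallyEq.deriv_eq ?_
    filter_upwards [isOpen_Ioo.mem_nhds hy] with s hs
    exact h1 s (Ioo_subset_Icc_self hs) t (Ioo_subset_Icc_self ht)
  refine ⟨?_, hy1 y hy, ?_⟩
  · refine Filter.EventuallyEq.deriv_eq ?_
    filter_upwards [isOpen_Ioo.mem_nhds ht] with s hs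
    exact h1 y (Ioo_subset_Icc_self hy) s (Ioo_subset_Icc_self hs)
  · refine Filter.EventuallyEq.deriv_eq ?_
    filter_upwards [isOpen_Ioo.mem_nhds hy] with s hs
    exact hy1 s hs

lemma bottom_eq (hu : RegSolution L T ε U P u₀ u₁ v₀ u) {x t : ℝ} (hx : x ∈ Icc 0 L)
    (ht : t ∈ Icc 0 T) :
    (u x 0 t + ε) * Dy u x 0 t = v₀ x t * (u x 0 t + ε) - pressureRatio U P x t := by
  have := hu.2.2.2.2.2 x hx t ht
  rw [this, pressureRatio]
  ring

lemma bottom_eq_deriv_x (hu : RegSolution L T ε U P u₀ u₁ v₀ u) (hE : EulerData L T M U P)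
    (hv : Smooth2 v₀) {x t : ℝ} (hx : x ∈ Ioo 0 L) (ht : t ∈ Icc 0 T) :
    Dx u x 0 t * Dy u x 0 t + (u x 0 t + ε) * Dy (Dx u) x 0 t =
      pd1 v₀ x t * (u x 0 t + ε) + v₀ x t * Dx u x 0 t - pd1 (pressureRatio U P) x t := by
  have hs : Smooth3 u := hu.1
  have hp := (hE.hasDerivAt_pressureRatio (Ioo_subset_Icc_self hx) ht).1
  have hl := ((hs.hasDerivAt_x x 0 t).add_const ε).mul (hs.dy.hasDerivAt_x x 0 t)
  have hr := ((hv.hasDerivAt_fst x t).mul ((hs.hasDerivAt_x x 0 t).add_const ε)).sub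
    hp.differentiableAt.hasDerivAt
  rw [hs.Dx_Dy] at hl
  refine hl.unique (hr.congr_of_eventuallyEq ?_)
  filter_upwards [isOpen_Ioo.mem_nhds hx] with s hs
  exact hu.bottom_eq (Ioo_subset_Icc_self hs) ht

lemma bottom_eq_deriv_t (hu : RegSolution L T ε U P u₀ u₁ v₀ u) (hE : EulerData L T M U P)
    (hv : Smooth2 v₀) {x t : ℝ} (hx : x ∈ Icc 0 L) (ht : t ∈ Ioo 0 T) :
    Dt u x 0 t * Dy u x 0 t + (u x 0 t + ε) * Dy (Dt u) x 0 t =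
      pd2 v₀ x t * (u x 0 t + ε) + v₀ x t * Dt u x 0 t - pd2 (pressureRatio U P) x t := by
  have hs : Smooth3 u := hu.1
  have hp := (hE.hasDerivAt_pressureRatio hx (Ioo_subset_Icc_self ht)).2
  have hl := ((hs.hasDerivAt_t x 0 t).add_const ε).mul (hs.dy.hasDerivAt_t x 0 t)
  have hr := ((hv.hasDerivAt_snd x t).mul ((hs.hasDerivAt_t x 0 t).add_const ε)).sub
    hp.differentiableAt.hasDerivAt
  rw [hs.Dt_Dy] at hl
  refine hl.unique (hr.congr_of_eventuallyEq ?_)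
  filter_upwards [isOpen_Ioo.mem_nhds ht] with s hs
  exact hu.bottom_eq hx (Ioo_subset_Icc_self hs)

theorem flowBounds {C₀ : ℝ} (hu : RegSolution L T ε U P u₀ u₁ v₀ u) (hE : EulerData L T M U P)
    (hD : DataBounds L T C₀ u₀ u₁ v₀) (hL : 0 < L) (hT : 0 < T) (hε : ε ∈ Ioo (0:ℝ) 1)
    (b₀ : C2Bound u₀ (Icc 0 L) (Icc 0 1) M) (b₁ : C2Bound u₁ (Icc 0 1) (Icc 0 T) M)
    (bv : C2Bound v₀ (Icc 0 L) (Icc 0 T) M) (hC₁ : 0 < C₁) (hC₁M : C₁ ≤ M)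
    (hb : ∀ x ∈ Ioo 0 L, ∀ y ∈ Ioo (0:ℝ) 1, ∀ t ∈ Ioo 0 T,
      C₁⁻¹ * (1 - y) ≤ u x y t ∧ u x y t ≤ C₁ * (1 - y)) :
    FlowBounds L T (4 * M ^ 5) ε U (pressureRatio U P) u := by
  have hC1 : 1 ≤ C₁ := by
    have h := hb (L / 2) ⟨by linarith, by linarith⟩ (1 / 2) ⟨by norm_num, by norm_num⟩ (T / 2)
      ⟨by linarith, by linarith⟩
    have h2 : C₁⁻¹ ≤ C₁ := by linarith [h.1, h.2]
    by_contra! hlt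
    have := (one_lt_inv₀ hC₁).2 hlt
    linarith
  have hM : 1 ≤ M := hC1.trans hC₁M
  have hM0 : 0 < M := by linarith
  have k1 : M ≤ M ^ 5 := le_self_pow₀ hM (by norm_num)
  have k2 : M ^ 2 ≤ M ^ 5 := pow_le_pow_right₀ hM (by norm_num)
  have k3 : M ^ 3 ≤ M ^ 5 := pow_le_pow_right₀ hM (by norm_num)
  have k4 : M ^ 4 ≤ M ^ 5 := pow_le_pow_right₀ hM (by norm_num)
  have hb' : ∀ q ∈ closedBox L T, M⁻¹ * (1 - q.2.1) ≤ u q.1 q.2.1 q.2.2 ∧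
      u q.1 q.2.1 q.2.2 ≤ M * (1 - q.2.1) := fun q hq => by
    have h := hu.bounds_on_closedBox hL hT hb hq
    have hy : 0 ≤ 1 - q.2.1 := by linarith [hq.2.1.2]
    have hi : M⁻¹ ≤ C₁⁻¹ := inv_anti₀ hC₁ hC₁M
    exact ⟨(mul_le_mul_of_nonneg_right hi hy).trans h.1,
      h.2.trans (mul_le_mul_of_nonneg_right hC₁M hy)⟩
  have hbot : ∀ x ∈ Icc 0 L, ∀ t ∈ Icc 0 T, M⁻¹ ≤ u x 0 t + ε := fun x hx t ht => by
    have := (hb' (x, 0, t) ⟨hx, ⟨le_rfl, zero_le_one⟩, ht⟩).1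
    simp only [sub_zero, mul_one] at this
    linarith [hε.1]
  obtain ⟨su₀, su₁, sv₀, e₀, e₁, -⟩ := hD
  have u₀_top : ∀ x ∈ Icc 0 L, u₀ x 1 = 0 := fun x hx => by
    have := e₀ x hx 1 ⟨zero_le_one, le_rfl⟩
    simp only [sub_self, mul_zero] at this
    exact le_antisymm this.2 this.1
  have u₁_top : ∀ t ∈ Icc 0 T, u₁ 1 t = 0 := fun t ht => by
    have := e₁ 1 ⟨zero_le_one, le_rfl⟩ t ht
    simp only [sub_self, mul_zero] at this
    exact le_antisymm this.2 this.1
  have hp := fun x hx t ht => hE.pressureRatio_bounds (x := x) (t := t) hM0 hx ht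
  obtain ⟨sU, -, hUpos, -, -, bU, -⟩ := id hE
  refine
    { one_le := by linarith
      eps_pos := hε.1
      eps_le := hε.2.le
      smooth_U := sU
      smooth_u := hu.1
      cont_p := hE.continuousOn_pressureRatio
      deriv_p := fun x hx t ht =>
        ⟨(hE.hasDerivAt_pressureRatio hx ht).1.differentiableAt.hasDerivAt,
          (hE.hasDerivAt_pressureRatio hx ht).2.differentiableAt.hasDerivAt⟩
      bound_U := fun x hx t ht => ?_
      bound_dU := fun x hx t ht => ?_
      bound_u := fun x hx y hy t ht => ?_
      eq := fun x hx y hy t ht => hu.eq_on_closedBox hE hL hT (q := (x, y, t)) ⟨hx, hy, ht⟩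
      top := hu.2.2.2.2.1
      bottom := fun x hx t ht => ?_
      initial := fun x hx y hy => ?_
      inflow := fun y hy t ht => ?_ }
  · obtain ⟨h1, h2, -⟩ := bU x hx t ht
    obtain ⟨h3, h4, -⟩ := hp x hx t ht
    exact ⟨(hUpos x hx t ht).le, by linarith [(abs_le.1 h1).2], by linarith, h3, by linarith⟩
  · obtain ⟨-, -, h1, h2, -, h3⟩ := bU x hx t ht
    obtain ⟨-, -, h4, h5⟩ := hp x hx t ht
    exact ⟨by linarith, by linarith, by linarith, by linarith, by linarith⟩
  · have h := hb' (x, y, t) ⟨hx, hy, ht⟩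
    have hr : 0 < 1 - y + ε := by linarith [hy.2, hε.1]
    have hy0 : 0 ≤ 1 - y := by linarith [hy.2]
    have hi : M⁻¹ ≤ 1 := inv_le_one_of_one_le₀ hM
    simp only at h
    refine ⟨(mul_nonneg (inv_pos.2 hM0).le hy0).trans h.1, ?_, ?_⟩
    · calc (1 - y + ε) / (4 * M ^ 5) ≤ (1 - y + ε) / M := by gcongr; linarith
        _ = M⁻¹ * (1 - y) + M⁻¹ * ε := by ring
        _ ≤ u x y t + ε := add_le_add h.1 (mul_le_of_le_one_left hε.1.le hi)
    · calc u x y t + ε ≤ M * (1 - y) + M * ε :=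
            add_le_add h.2 (le_mul_of_one_le_left hε.1.le hM)
        _ = M * (1 - y + ε) := by ring
        _ ≤ 4 * M ^ 5 * (1 - y + ε) := by gcongr; linarith
  · have hx' := Ioo_subset_Icc_self hx
    have ht' := Ioo_subset_Icc_self ht
    have h0 := hu.bottom_eq hx' ht'
    have hs := hbot x hx' t ht'
    obtain ⟨v1, v2, v3, -⟩ := bv x hx' t ht'
    obtain ⟨p0, p1, p2, p3⟩ := hp x hx' t ht'
    refine ⟨?_, bottom_deriv_bound hM hs v2 p2 h0 (hu.bottom_eq_deriv_x hE sv₀ hx ht'),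
      bottom_deriv_bound hM hs v3 p3 h0 (hu.bottom_eq_deriv_t hE sv₀ hx' ht)⟩
    have hs0 : 0 < u x 0 t + ε := (inv_pos.2 hM0).trans_le hs
    have hi : (u x 0 t + ε)⁻¹ ≤ M := inv_le_of_inv_le₀ hM0 hs
    have e : Dy u x 0 t = v₀ x t - pressureRatio U P x t * (u x 0 t + ε)⁻¹ := by
      field_simp
      linear_combination h0
    have h2 : |pressureRatio U P x t * (u x 0 t + ε)⁻¹| ≤ M ^ 2 * M := by
      rw [abs_mul, abs_of_nonneg (inv_pos.2 hs0).le, abs_of_nonneg p0]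
      gcongr
    rw [e]
    refine (abs_sub _ _).trans ?_
    linarith
  · have hx' := Ioo_subset_Icc_self hx
    have hy' := Ioo_subset_Icc_self hy
    obtain ⟨d1, d2, d3⟩ := hu.initial_derivs hx hy
    obtain ⟨-, -, c2, -, c3, -⟩ := b₀ x hx' y hy'
    rw [d1, d2, d3]
    have htop : pd1 u₀ x 1 = 0 := (su₀.hasDerivAt_fst x 1).unique
      ((hasDerivAt_const x (0:ℝ)).congr_of_eventuallyEq (by
        filter_upwards [isOpen_Ioo.mem_nhds hx] with s hs
        exact u₀_top s (Ioo_subset_Icc_self hs)))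
    have := abs_le_mul_one_sub (f := pd1 u₀ x)
      (fun s _ => su₀.smooth2_pd1.hasDerivAt_snd x s)
      (fun s hs => (b₀ x hx' s hs).2.2.2.2.2) htop hy'
    refine ⟨this.trans ?_, by linarith, by linarith⟩
    have : 0 ≤ 1 - y := by linarith [hy.2]
    gcongr
    linarith
  · have ht' := Ioo_subset_Icc_self ht
    have hy' := Ioo_subset_Icc_self hy
    obtain ⟨d1, d2, d3⟩ := hu.inflow_derivs hy ht
    obtain ⟨-, c2, -, c3, -⟩ := b₁ y hy' t ht'
    rw [d1, d2, d3]
    have htop : pd2 u₁ 1 t = 0 := (su₁.hasDerivAt_snd 1 t).unique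
      ((hasDerivAt_const t (0:ℝ)).congr_of_eventuallyEq (by
        filter_upwards [isOpen_Ioo.mem_nhds ht] with s hs
        exact u₁_top s (Ioo_subset_Icc_self hs)))
    have := abs_le_mul_one_sub (f := fun s => pd2 u₁ s t)
      (fun s _ => su₁.smooth2_pd2.hasDerivAt_fst s t)
      (fun s hs => by rw [su₁.pd1_pd2]; exact (b₁ s hs t ht').2.2.2.2.2) htop hy'
    refine ⟨this.trans ?_, by linarith, by linarith⟩
    have : 0 ≤ 1 - y := by linarith [hy.2]
    gcongr
    linarith

end RegSolution

/-- Corollary 2.6: uniform weighted bound on the second derivative `∂_y² u` of the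
regularized solutions, for any weight exponent `α > 0`. -/
theorem weighted_second_derivative_bound (L T C₀ M α : ℝ)
    (hL : 0 < L) (hT : 0 < T) (hC₀ : 0 < C₀) (hM : 0 < M) (hα : 0 < α) :
    ∃ C₅ > (0:ℝ), ∀ ε ∈ Ioo (0:ℝ) 1, ∀ U P : ℝ → ℝ → ℝ, ∀ u₀ u₁ v₀ : ℝ → ℝ → ℝ,
      ∀ u : ℝ → ℝ → ℝ → ℝ, ∀ C₁ : ℝ,
      EulerData L T M U P →
      DataBounds L T C₀ u₀ u₁ v₀ →
      C2Bound u₀ (Icc 0 L) (Icc 0 1) M →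
      C2Bound u₁ (Icc 0 1) (Icc 0 T) M →
      C2Bound v₀ (Icc 0 L) (Icc 0 T) M →
      RegSolution L T ε U P u₀ u₁ v₀ u →
      0 < C₁ → C₁ ≤ M →
      (∀ x ∈ Ioo 0 L, ∀ y ∈ Ioo (0:ℝ) 1, ∀ t ∈ Ioo 0 T,
        C₁⁻¹ * (1 - y) ≤ u x y t ∧ u x y t ≤ C₁ * (1 - y)) →
      ∫⁻ p in QT L T,
          ENNReal.ofReal ((1 - p.2.1) ^ α * |Dyy u p.1 p.2.1 p.2.2|)
        ≤ ENNReal.ofReal C₅ := by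
  have hβ : 0 < min α (1 / 2) := lt_min hα (by norm_num)
  have hβ1 : min α (1 / 2) < 1 := (min_le_right _ _).trans_lt (by norm_num)
  obtain ⟨C, hC⟩ := exists_weighted_Dyy_bound (4 * M ^ 5) hL.le hT.le hβ hβ1
  refine ⟨max C 1, by positivity, ?_⟩
  intro ε hε U P u₀ u₁ v₀ u C₁ hE hD b₀ b₁ bv hu hC₁ hC₁M hb
  have h := hu.flowBounds hE hD hL hT hε b₀ b₁ bv hC₁ hC₁M hb
  have hint : IntegrableOn (fun q : ℝ × ℝ × ℝ => (1 - q.2.1 + ε) ^ min α (1 / 2) *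
      |Dy (Dy u) q.1 q.2.1 q.2.2|) (QT L T) := integrableOn_QT
    ((h.continuousOn_weight _).mul h.smooth_u.dy.dy.continuous.abs.continuousOn)
  calc ∫⁻ p in QT L T, ENNReal.ofReal ((1 - p.2.1) ^ α * |Dyy u p.1 p.2.1 p.2.2|)
      ≤ ∫⁻ q in QT L T, ENNReal.ofReal ((1 - q.2.1 + ε) ^ min α (1 / 2) *
          |Dy (Dy u) q.1 q.2.1 q.2.2|) := by
        refine setLIntegral_mono' (measurableSet_QT L T) fun q hq => ENNReal.ofReal_le_ofReal ?_
        have hy : 0 < 1 - q.2.1 := by linarith [hq.2.1.2]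
        rw [Dyy_eq]
        gcongr
        calc (1 - q.2.1) ^ α ≤ (1 - q.2.1) ^ min α (1 / 2) :=
              rpow_le_rpow_of_exponent_ge hy (by linarith [hq.2.1.1]) (min_le_left _ _)
          _ ≤ (1 - q.2.1 + ε) ^ min α (1 / 2) :=
              rpow_le_rpow hy.le (by linarith [hε.1]) hβ.le
    _ = ENNReal.ofReal (∫ q in QT L T, (1 - q.2.1 + ε) ^ min α (1 / 2) *
          |Dy (Dy u) q.1 q.2.1 q.2.2|) := by
        refine (ofReal_integral_eq_lintegral_ofReal hint ?_).symm
        filter_upwards [ae_restrict_mem (measurableSet_QT L T)] with q hq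
        exact mul_nonneg (rpow_nonneg (h.r_pos (QT_subset_closedBox L T hq)).le _) (abs_nonneg _)
    _ ≤ ENNReal.ofReal (max C 1) :=
        ENNReal.ofReal_le_ofReal ((hC ε U _ u h).trans (le_max_left _ _))

end
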